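/- (Brunn–Minkowski inequality for torsional rigidity) If Ω and Ω̃ are convex bodies in ℝⁿ and t ∈ [0,1], then T((1-t)Ω + tΩ̃)^(1/(n+2)) ≥ (1-t)·T(Ω)^(1/(n+2)) + t·T(Ω̃)^(1/(n+2)), with equality if and only if Ω is homothetic to Ω̃. -/

import Mathlib

open MeasureTheory
open scoped Pointwise

/-- The Euclidean Laplacian, as the sum of second derivatives in coordinate directions. -/
noncomputable def lap {n : ℕ} (f : EuclideanSpace ℝ (Fin n) → ℝ)
    (x : EuclideanSpace ℝ (Fin n)) : ℝ :=
  ∑ i : Fin n, fderiv ℝ (fun y => fderiv ℝ f y (EuclideanSpace.single i 1)) x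
    (EuclideanSpace.single i 1)

/-- `U` is the torsion function of the body `Ω`. -/
def IsTorsionFn {n : ℕ} (Ω : Set (EuclideanSpace ℝ (Fin n)))
    (U : EuclideanSpace ℝ (Fin n) → ℝ) : Prop :=
  ContinuousOn U (closure Ω) ∧ ContDiffOn ℝ 2 U (interior Ω) ∧
    (∀ x ∈ interior Ω, lap U x = -2) ∧ ∀ x ∈ frontier Ω, U x = 0

/-- The torsional rigidity of a body `Ω` with torsion function `U`: `T(Ω) = ∫_Ω |∇U|²`. -/
noncomputable def torsion {n : ℕ} (Ω : Set (EuclideanSpace ℝ (Fin n)))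
    (U : EuclideanSpace ℝ (Fin n) → ℝ) : ℝ :=
  ∫ x in Ω, ‖gradient U x‖ ^ 2


/-! ### Second derivatives along lines and the two-point maximum principle -/

/-- `f` is differentiable near `0`, with first derivative `d1` and second derivative `d2` at `0`. -/
def HasD2 (f : ℝ → ℝ) (d1 d2 : ℝ) : Prop :=
  ∃ f' : ℝ → ℝ, (∀ᶠ s in nhds 0, HasDerivAt f (f' s) s) ∧ f' 0 = d1 ∧ HasDerivAt f' d2 0

lemma HasD2.const (c : ℝ) : HasD2 (fun _ => c) 0 0 :=
  ⟨fun _ => 0, Filter.Eventually.of_forall fun s => hasDerivAt_const s c, rfl,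
    hasDerivAt_const _ _⟩

lemma HasD2.sub {f g : ℝ → ℝ} {d1 d2 e1 e2 : ℝ} (hf : HasD2 f d1 d2) (hg : HasD2 g e1 e2) :
    HasD2 (fun s => f s - g s) (d1 - e1) (d2 - e2) := by
  obtain ⟨f', h1, h2, h3⟩ := hf
  obtain ⟨g', k1, k2, k3⟩ := hg
  refine ⟨fun s => f' s - g' s, ?_, by simp [h2, k2], h3.sub k3⟩
  filter_upwards [h1, k1] with s a b using a.sub b

lemma HasD2.const_mul {f : ℝ → ℝ} {d1 d2 : ℝ} (c : ℝ) (hf : HasD2 f d1 d2) :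
    HasD2 (fun s => c * f s) (c * d1) (c * d2) := by
  obtain ⟨f', h1, h2, h3⟩ := hf
  refine ⟨fun s => c * f' s, ?_, by simp [h2], h3.const_mul c⟩
  filter_upwards [h1] with s a using a.const_mul c

lemma HasD2.scale {f : ℝ → ℝ} {d1 d2 : ℝ} (c : ℝ) (hf : HasD2 f d1 d2) :
    HasD2 (fun s => f (c * s)) (c * d1) (c ^ 2 * d2) := by
  obtain ⟨f', h1, h2, h3⟩ := hf
  have hlin : ∀ s : ℝ, HasDerivAt (fun s : ℝ => c * s) c s := fun s => by
    simpa using (hasDerivAt_id s).const_mul c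
  have ht : Filter.Tendsto (fun s : ℝ => c * s) (nhds 0) (nhds 0) := by
    have hcc : Continuous fun s : ℝ => c * s := by fun_prop
    simpa using hcc.tendsto 0
  refine ⟨fun s => c * f' (c * s), ?_, by simp [h2], ?_⟩
  · filter_upwards [ht.eventually h1] with s a
    have := a.comp s (hlin s)
    rw [mul_comm] at this
    exact this
  · have h3' : HasDerivAt f' d2 (c * 0) := by simpa using h3
    have := (h3'.comp 0 (hlin 0)).const_mul c
    rw [show c ^ 2 * d2 = c * (d2 * c) by ring]
    exact this

lemma HasD2.isLocalMin {f : ℝ → ℝ} {d1 d2 : ℝ} (hf : HasD2 f d1 d2) (hm : IsLocalMin f 0) :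
    d1 = 0 ∧ 0 ≤ d2 := by
  obtain ⟨f', h1, h2, h3⟩ := hf
  have hd : f' 0 = 0 := hm.hasDerivAt_eq_zero h1.self_of_nhds
  refine ⟨h2 ▸ hd, ?_⟩
  by_contra! hneg
  have hderiv : deriv f =ᶠ[nhds 0] f' := by
    filter_upwards [h1] with s hs using hs.deriv
  have hdd : deriv (deriv f) 0 = d2 := by
    rw [hderiv.deriv_eq]; exact h3.deriv
  have hmax : IsLocalMax f 0 := by
    apply isLocalMax_of_deriv_deriv_neg
    · rw [hdd]; exact hneg
    · rw [hderiv.eq_of_nhds, hd]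
    · exact h1.self_of_nhds.continuousAt
  have hc : f =ᶠ[nhds 0] fun _ => f 0 := by
    filter_upwards [hm, hmax] with s a b using le_antisymm b a
  have : deriv (deriv f) 0 = 0 := by
    rw [hc.deriv.deriv_eq]; simp
  linarith

lemma HasD2.sqrt {f : ℝ → ℝ} {d1 d2 : ℝ} (hf : HasD2 f d1 d2) (h0 : 0 < f 0) :
    HasD2 (fun s => √(f s)) (d1 / (2 * √(f 0)))
      (d2 / (2 * √(f 0)) - d1 ^ 2 / (4 * √(f 0) ^ 3)) := by
  obtain ⟨f', h1, h2, h3⟩ := hf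
  have hc : ContinuousAt f 0 := h1.self_of_nhds.continuousAt
  have hs : 0 < √(f 0) := Real.sqrt_pos.mpr h0
  refine ⟨fun s => f' s / (2 * √(f s)), ?_, by simp [h2], ?_⟩
  · filter_upwards [h1, hc.eventually (lt_mem_nhds h0)] with s a b
    exact a.sqrt b.ne'
  · have h4 := (h1.self_of_nhds.sqrt h0.ne').const_mul 2
    have h5 := h3.div h4 (by positivity)
    have h6 : d2 / (2 * √(f 0)) - d1 ^ 2 / (4 * √(f 0) ^ 3) =
        (d2 * (2 * √(f 0)) - f' 0 * (2 * (f' 0 / (2 * √(f 0))))) / (2 * √(f 0)) ^ 2 := by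
      rw [h2]
      field_simp
      ring
    rw [h6]
    exact h5

section TwoPoint

variable {n : ℕ}

local notation "E" => EuclideanSpace ℝ (Fin n)

lemma hasD2_line {S : Set E} {U : E → ℝ} (hS : IsOpen S) (hU : ContDiffOn ℝ 2 U S) {x : E}
    (hx : x ∈ S) (v : E) :
    HasD2 (fun s => U (x + s • v)) (fderiv ℝ U x v)
      (fderiv ℝ (fun y => fderiv ℝ U y v) x v) := by
  have hl : ∀ s : ℝ, HasDerivAt (fun s : ℝ => x + s • v) v s := fun s => by
    simpa using ((hasDerivAt_id s).smul_const v).const_add x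
  have hcont : Continuous fun s : ℝ => x + s • v := by fun_prop
  have hx0 : x + (0 : ℝ) • v = x := by simp
  refine ⟨fun s => fderiv ℝ U (x + s • v) v, ?_, by simp, ?_⟩
  · have : ∀ᶠ s : ℝ in nhds 0, x + s • v ∈ S :=
      hcont.continuousAt.eventually (by simpa using hS.mem_nhds hx)
    filter_upwards [this] with s hs
    have hd : DifferentiableAt ℝ U (x + s • v) :=
      (hU.differentiableOn (by norm_num)).differentiableAt (hS.mem_nhds hs)
    exact hd.hasFDerivAt.comp_hasDerivAt s (hl s)
  · have h1 : ContDiffOn ℝ 1 (fderiv ℝ U) S := hU.fderiv_of_isOpen hS (by norm_num)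
    have h2 : DifferentiableAt ℝ (fderiv ℝ U) x :=
      (h1.differentiableOn (by norm_num)).differentiableAt (hS.mem_nhds hx)
    have h3 : DifferentiableAt ℝ (fun y => fderiv ℝ U y v) x :=
      h2.clm_apply (differentiableAt_const v)
    have h4 : HasFDerivAt (fun y => fderiv ℝ U y v) (fderiv ℝ (fun y => fderiv ℝ U y v) x)
        (x + (0 : ℝ) • v) := by rw [hx0]; exact h3.hasFDerivAt
    exact h4.comp_hasDerivAt (0 : ℝ) (hl 0)

/-- An interior local minimum forces a nonnegative Laplacian; so torsion functions have none. -/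
lemma torsion_not_localMin {Ω : Set E} {U : E → ℝ} (hU : IsTorsionFn Ω U) {x : E}
    (hx : x ∈ interior Ω) : ¬ ∀ y ∈ Ω, U x ≤ U y := by
  intro hmin
  have h := hU.2.2.1 x hx
  have : 0 ≤ lap U x := by
    refine Finset.sum_nonneg fun i _ => ?_
    refine ((hasD2_line isOpen_interior hU.2.1 hx (EuclideanSpace.single i 1)).isLocalMin ?_).2
    have hcont : Continuous fun s : ℝ => x + s • (EuclideanSpace.single i 1 : E) := by fun_prop
    have : ∀ᶠ s : ℝ in nhds 0, x + s • (EuclideanSpace.single i 1 : E) ∈ interior Ω :=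
      hcont.continuousAt.eventually (by simpa using isOpen_interior.mem_nhds hx)
    filter_upwards [this] with s hs
    simpa using hmin _ (interior_subset hs)
  linarith

lemma mem_interior_or_frontier {Ω : Set E} {x : E} (hx : x ∈ Ω) :
    x ∈ interior Ω ∨ x ∈ frontier Ω := by
  by_cases h : x ∈ interior Ω
  · exact Or.inl h
  · exact Or.inr ⟨subset_closure hx, h⟩

lemma torsion_nonneg {Ω : Set E} {U : E → ℝ} (hc : IsCompact Ω) (hU : IsTorsionFn Ω U) {x : E}
    (hx : x ∈ Ω) : 0 ≤ U x := by
  obtain ⟨m, hm, hmin⟩ := hc.exists_isMinOn ⟨x, hx⟩ (hU.1.mono subset_closure)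
  rcases mem_interior_or_frontier hm with h | h
  · exact absurd (fun y hy => hmin hy) (torsion_not_localMin hU h)
  · have := hmin hx
    simp only [Set.mem_ofPred_eq, hU.2.2.2 m h] at this
    exact this

lemma torsion_pos {Ω : Set E} {U : E → ℝ} (hc : IsCompact Ω) (hU : IsTorsionFn Ω U) {x : E}
    (hx : x ∈ interior Ω) : 0 < U x := by
  rcases (torsion_nonneg hc hU (interior_subset hx)).lt_or_eq with h | h
  · exact h
  · exact absurd (fun y hy => h ▸ torsion_nonneg hc hU hy) (torsion_not_localMin hU hx)

lemma torsion_interior_of_pos {Ω : Set E} {U : E → ℝ} (hU : IsTorsionFn Ω U) {x : E}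
    (hx : x ∈ Ω) (h : U x ≠ 0) : x ∈ interior Ω :=
  (mem_interior_or_frontier hx).resolve_right fun hf => h (hU.2.2.2 x hf)

/-- second-order data of `√U` along the `i`-th coordinate line with speed `a` -/
lemma hasD2_sqrt_line {Ω : Set E} {U : E → ℝ} (hc : IsCompact Ω) (hU : IsTorsionFn Ω U) {x : E}
    (hx : x ∈ interior Ω) (a : ℝ) (i : Fin n) :
    HasD2 (fun s => √(U (x + (a * s) • EuclideanSpace.single i 1)))
      (a * (fderiv ℝ U x (EuclideanSpace.single i 1) / (2 * √(U x))))
      (a ^ 2 * (fderiv ℝ (fun y => fderiv ℝ U y (EuclideanSpace.single i 1)) x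
        (EuclideanSpace.single i 1) / (2 * √(U x)) -
          fderiv ℝ U x (EuclideanSpace.single i 1) ^ 2 / (4 * √(U x) ^ 3))) := by
  have h := hasD2_line isOpen_interior hU.2.1 hx (EuclideanSpace.single i 1)
  have h2 := (h.sqrt (by simpa using torsion_pos hc hU hx)).scale a
  simpa using h2

lemma sum_d2 {Ω : Set E} {U : E → ℝ} (hc : IsCompact Ω) (hU : IsTorsionFn Ω U) {x : E}
    (hx : x ∈ interior Ω) :
    ∑ i : Fin n, (fderiv ℝ (fun y => fderiv ℝ U y (EuclideanSpace.single i 1)) x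
        (EuclideanSpace.single i 1) / (2 * √(U x)) -
          fderiv ℝ U x (EuclideanSpace.single i 1) ^ 2 / (4 * √(U x) ^ 3)) =
      - (1 + ∑ i : Fin n, (fderiv ℝ U x (EuclideanSpace.single i 1) / (2 * √(U x))) ^ 2)
        / √(U x) := by
  have hs : 0 < √(U x) := Real.sqrt_pos.mpr (torsion_pos hc hU hx)
  have hl : lap U x = -2 := hU.2.2.1 x hx
  unfold lap at hl
  rw [Finset.sum_sub_distrib, ← Finset.sum_div, hl, ← Finset.sum_div]
  simp_rw [div_pow]
  rw [← Finset.sum_div]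
  field_simp
  ring

/-- The two-point maximum principle. -/
lemma two_point {Ω Ω' Ωt : Set E} {U U' Ut : E → ℝ} (hc : IsCompact Ω) (hc' : IsCompact Ω')
    (hct : IsCompact Ωt) (hU : IsTorsionFn Ω U) (hU' : IsTorsionFn Ω' U')
    (hUt : IsTorsionFn Ωt Ut) {α β : ℝ} (c : E)
    (hmap : ∀ x ∈ Ω, ∀ y ∈ Ω', c + α • x + β • y ∈ Ωt) {x y : E} (hx : x ∈ Ω) (hy : y ∈ Ω') :
    α * √(U x) + β * √(U' y) ≤ √(Ut (c + α • x + β • y)) := by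
  let F : E × E → ℝ := fun p =>
    √(Ut (c + α • p.1 + β • p.2)) - α * √(U p.1) - β * √(U' p.2)
  have hFc : ContinuousOn F (Ω ×ˢ Ω') := by
    have hUc : ContinuousOn U Ω := hU.1.mono subset_closure
    have hUc' : ContinuousOn U' Ω' := hU'.1.mono subset_closure
    have hUct : ContinuousOn Ut Ωt := hUt.1.mono subset_closure
    have h1 : ContinuousOn (fun p : E × E => Ut (c + α • p.1 + β • p.2)) (Ω ×ˢ Ω') :=
      hUct.comp (by fun_prop) fun p hp => hmap _ hp.1 _ hp.2
    have h2 : ContinuousOn (fun p : E × E => U p.1) (Ω ×ˢ Ω') :=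
      hUc.comp (by fun_prop) fun p hp => hp.1
    have h3 : ContinuousOn (fun p : E × E => U' p.2) (Ω ×ˢ Ω') :=
      hUc'.comp (by fun_prop) fun p hp => hp.2
    exact (h1.sqrt.sub (h2.sqrt.const_mul α)).sub (h3.sqrt.const_mul β)
  obtain ⟨⟨x0, y0⟩, hm, hmin⟩ := (hc.prod hc').exists_isMinOn ⟨(x, y), hx, hy⟩ hFc
  have hx0 : x0 ∈ Ω := hm.1
  have hy0 : y0 ∈ Ω' := hm.2
  have hminF : ∀ x ∈ Ω, ∀ y ∈ Ω', F (x0, y0) ≤ F (x, y) := fun x hx y hy =>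
    hmin (show (x, y) ∈ Ω ×ˢ Ω' from ⟨hx, hy⟩)
  suffices h : 0 ≤ F (x0, y0) by
    have := h.trans (hminF x hx y hy)
    simp only [F] at this
    linarith
  by_contra! hneg
  set z := c + α • x0 + β • y0 with hz
  set a := √(U x0) with ha
  set b := √(U' y0) with hb
  set w := √(Ut z) with hw
  have hneg' : w < α * a + β * b := by
    simp only [F] at hneg
    linarith
  have ha0 : 0 ≤ a := Real.sqrt_nonneg _
  have hb0 : 0 ≤ b := Real.sqrt_nonneg _
  have hw0 : 0 ≤ w := Real.sqrt_nonneg _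
  have hax : a ≠ 0 → x0 ∈ interior Ω := fun h =>
    torsion_interior_of_pos hU hx0 fun h' => h (by rw [ha, h', Real.sqrt_zero])
  have hby : b ≠ 0 → y0 ∈ interior Ω' := fun h =>
    torsion_interior_of_pos hU' hy0 fun h' => h (by rw [hb, h', Real.sqrt_zero])
  -- `z` is an interior point
  have hzi : z ∈ interior Ωt := by
    have key : ∀ (γ : ℝ) (v : E) (S : Set E) (u : E), γ ≠ 0 → u ∈ interior S →
        (∀ q ∈ S, v + γ • q ∈ Ωt) → v + γ • u ∈ interior Ωt := by
      intro γ v S u hγ hu hq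
      rw [mem_interior_iff_mem_nhds] at hu ⊢
      have hinv : Filter.Tendsto (fun p : E => γ⁻¹ • (p - v)) (nhds (v + γ • u)) (nhds u) := by
        have : Continuous fun p : E => γ⁻¹ • (p - v) := by fun_prop
        have h := this.tendsto (v + γ • u)
        simpa [smul_smul, inv_mul_cancel₀ hγ] using h
      filter_upwards [hinv hu] with p hp
      have := hq _ hp
      simpa [smul_smul, mul_inv_cancel₀ hγ] using this
    by_cases h : α * a = 0
    · have hbb : β * b ≠ 0 := fun h' => by linarith
      have := key β (c + α • x0) Ω' y0 (left_ne_zero_of_mul hbb)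
        (hby (right_ne_zero_of_mul hbb)) fun q hq => hmap _ hx0 _ hq
      exact this
    · have := key α (c + β • y0) Ω x0 (left_ne_zero_of_mul h)
        (hax (right_ne_zero_of_mul h)) fun q hq => by
          have := hmap _ hq _ hy0
          rwa [add_right_comm] at this
      rwa [hz, add_right_comm]
  have hwpos : 0 < w := Real.sqrt_pos.mpr (torsion_pos hct hUt hzi)
  -- abbreviations for derivatives
  let e : Fin n → E := fun i => EuclideanSpace.single i 1
  let p : Fin n → ℝ := fun i => fderiv ℝ U x0 (e i) / (2 * a)
  let p' : Fin n → ℝ := fun i => fderiv ℝ U' y0 (e i) / (2 * b)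
  let q : Fin n → ℝ := fun i => fderiv ℝ Ut z (e i) / (2 * w)
  let H : Fin n → ℝ := fun i => fderiv ℝ (fun y => fderiv ℝ U y (e i)) x0 (e i) / (2 * a) -
    fderiv ℝ U x0 (e i) ^ 2 / (4 * a ^ 3)
  let H' : Fin n → ℝ := fun i => fderiv ℝ (fun y => fderiv ℝ U' y (e i)) y0 (e i) / (2 * b) -
    fderiv ℝ U' y0 (e i) ^ 2 / (4 * b ^ 3)
  let Ht : Fin n → ℝ := fun i => fderiv ℝ (fun y => fderiv ℝ Ut y (e i)) z (e i) / (2 * w) -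
    fderiv ℝ Ut z (e i) ^ 2 / (4 * w ^ 3)
  have ev : ∀ (S : Set E) (u : E) (r : ℝ) (i : Fin n), u ∈ S → (r ≠ 0 → u ∈ interior S) →
      ∀ᶠ s : ℝ in nhds 0, u + (r * s) • e i ∈ S := by
    intro S u r i hu hr
    by_cases h : r = 0
    · simp [h, hu]
    · have hcont : Continuous fun s : ℝ => u + (r * s) • e i := by fun_prop
      refine (hcont.continuousAt.eventually (p := fun y => y ∈ interior S) ?_).mono
        fun s hs => interior_subset hs
      simpa using isOpen_interior.mem_nhds (hr h)
  -- general variation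
  have var : ∀ (r r' : ℝ) (i : Fin n), (r ≠ 0 → x0 ∈ interior Ω) → (r' ≠ 0 → y0 ∈ interior Ω') →
      (α * r + β * r') * q i - α * (r * p i) - β * (r' * p' i) = 0 ∧
      0 ≤ (α * r + β * r') ^ 2 * Ht i - α * (r ^ 2 * H i) - β * (r' ^ 2 * H' i) := by
    intro r r' i hr hr'
    have d1 : HasD2 (fun s => √(U (x0 + (r * s) • e i))) (r * p i) (r ^ 2 * H i) := by
      by_cases h : r = 0
      · subst h; simpa using HasD2.const _
      · exact hasD2_sqrt_line hc hU (hr h) r i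
    have d2 : HasD2 (fun s => √(U' (y0 + (r' * s) • e i))) (r' * p' i) (r' ^ 2 * H' i) := by
      by_cases h : r' = 0
      · subst h; simpa using HasD2.const _
      · exact hasD2_sqrt_line hc' hU' (hr' h) r' i
    have d3 : HasD2 (fun s => √(Ut (z + ((α * r + β * r') * s) • e i)))
        ((α * r + β * r') * q i) ((α * r + β * r') ^ 2 * Ht i) :=
      hasD2_sqrt_line hct hUt hzi _ i
    refine ((d3.sub (d1.const_mul α)).sub (d2.const_mul β)).isLocalMin ?_
    filter_upwards [ev Ω x0 r i hx0 hr, ev Ω' y0 r' i hy0 hr'] with s hs hs'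
    have := hminF _ hs _ hs'
    simp only [F] at this
    have hzz : c + α • (x0 + (r * s) • e i) + β • (y0 + (r' * s) • e i) =
        z + ((α * r + β * r') * s) • e i := by
      rw [hz]; module
    rw [hzz] at this
    simpa using this
  have g1 : ∀ i, α * a * (q i - p i) = 0 := by
    intro i
    by_cases h : a = 0
    · simp [h]
    · have := (var 1 0 i (fun _ => hax h) (fun h => absurd rfl h)).1
      linear_combination a * this
  have g2 : ∀ i, β * b * (q i - p' i) = 0 := by
    intro i
    by_cases h : b = 0
    · simp [h]
    · have := (var 0 1 i (fun h => absurd rfl h) (fun _ => hby h)).1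
      linear_combination b * this
  set κ := α * a + β * b with hκ
  have hsum : 0 ≤ ∑ i, (κ ^ 2 * Ht i - α * (a ^ 2 * H i) - β * (b ^ 2 * H' i)) :=
    Finset.sum_nonneg fun i _ => (var a b i hax hby).2
  have s1 : ∑ i, Ht i = -(1 + ∑ i, q i ^ 2) / w := sum_d2 hct hUt hzi
  have s2 : α * (a ^ 2 * ∑ i, H i) = - (α * a) * (1 + ∑ i, q i ^ 2) := by
    by_cases h : a = 0
    · simp [h]
    · have h1 : ∑ i, H i = -(1 + ∑ i, p i ^ 2) / a := sum_d2 hc hU (hax h)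
      have h2 : α * a * ∑ i, p i ^ 2 = α * a * ∑ i, q i ^ 2 := by
        rw [Finset.mul_sum, Finset.mul_sum]
        exact Finset.sum_congr rfl fun i _ => by linear_combination -(p i + q i) * g1 i
      have h3 : α * (a ^ 2 * (-(1 + ∑ i, p i ^ 2) / a)) =
          -(α * a) - α * a * ∑ i, p i ^ 2 := by
        field_simp
        ring
      rw [h1, h3, h2]
      ring
  have s3 : β * (b ^ 2 * ∑ i, H' i) = - (β * b) * (1 + ∑ i, q i ^ 2) := by
    by_cases h : b = 0
    · simp [h]
    · have h1 : ∑ i, H' i = -(1 + ∑ i, p' i ^ 2) / b := sum_d2 hc' hU' (hby h)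
      have h2 : β * b * ∑ i, p' i ^ 2 = β * b * ∑ i, q i ^ 2 := by
        rw [Finset.mul_sum, Finset.mul_sum]
        exact Finset.sum_congr rfl fun i _ => by linear_combination -(p' i + q i) * g2 i
      have h3 : β * (b ^ 2 * (-(1 + ∑ i, p' i ^ 2) / b)) =
          -(β * b) - β * b * ∑ i, p' i ^ 2 := by
        field_simp
        ring
      rw [h1, h3, h2]
      ring
  rw [Finset.sum_sub_distrib, Finset.sum_sub_distrib, ← Finset.mul_sum, ← Finset.mul_sum,
    ← Finset.mul_sum, ← Finset.mul_sum, ← Finset.mul_sum, s1, s2, s3] at hsum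
  have hQ : 0 ≤ ∑ i, q i ^ 2 := Finset.sum_nonneg fun i _ => sq_nonneg _
  have h5 : 0 ≤ (1 + ∑ i, q i ^ 2) * (κ - κ ^ 2 / w) := by
    have : (1 + ∑ i, q i ^ 2) * (κ - κ ^ 2 / w) =
      κ ^ 2 * (-(1 + ∑ i, q i ^ 2) / w) - -(α * a) * (1 + ∑ i, q i ^ 2) -
        -(β * b) * (1 + ∑ i, q i ^ 2) := by rw [hκ]; ring
    rw [this]; exact hsum
  have h6 : 0 ≤ κ - κ ^ 2 / w := nonneg_of_mul_nonneg_right h5 (by positivity)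
  have h7 : κ ^ 2 / w ≤ κ := by linarith
  rw [div_le_iff₀ hwpos] at h7
  nlinarith

end TwoPoint

/-! ### Torsional rigidity as twice the integral of the torsion function -/

section Rigidity

variable {n : ℕ}

local notation "E" => EuclideanSpace ℝ (Fin n)

lemma ext_continuous {Ω : Set E} {U : E → ℝ} (hU : IsTorsionFn Ω U) :
    Continuous (Ω.indicator U) :=
  continuous_indicator hU.2.2.2 hU.1

lemma ext_support {Ω : Set E} {U : E → ℝ} (hc : IsCompact Ω) :
    HasCompactSupport (Ω.indicator U) :=
  HasCompactSupport.of_support_subset_isCompact hc Set.support_indicator_subset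

lemma ext_nonneg {Ω : Set E} {U : E → ℝ} (hc : IsCompact Ω) (hU : IsTorsionFn Ω U) (x : E) :
    0 ≤ Ω.indicator U x :=
  Set.indicator_nonneg (fun _ hx => torsion_nonneg hc hU hx) x

lemma ext_pos_iff {Ω : Set E} {U : E → ℝ} (hc : IsCompact Ω) (hU : IsTorsionFn Ω U) (x : E) :
    0 < Ω.indicator U x ↔ x ∈ interior Ω := by
  constructor
  · intro h
    by_cases hx : x ∈ Ω
    · rw [Set.indicator_of_mem hx] at h
      exact torsion_interior_of_pos hU hx h.ne'
    · rw [Set.indicator_of_notMem hx] at h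
      exact absurd h (lt_irrefl _)
  · intro h
    rw [Set.indicator_of_mem (interior_subset h)]
    exact torsion_pos hc hU h

lemma ext_integrable {Ω : Set E} {U : E → ℝ} (hc : IsCompact Ω) (hU : IsTorsionFn Ω U) :
    Integrable (Ω.indicator U) :=
  (ext_continuous hU).integrable_of_hasCompactSupport (ext_support hc)

/-- Cut-off ratio. -/
noncomputable def cutR (ε s : ℝ) : ℝ := max (s - ε) 0 / s

/-- Cut-off function `(s-ε)₊² / s`. -/
noncomputable def cutF (ε s : ℝ) : ℝ := max (s - ε) 0 ^ 2 / s

/-- Derivative of the cut-off function. -/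
noncomputable def cutD (ε s : ℝ) : ℝ := 2 * cutR ε s - cutR ε s ^ 2

lemma hasDerivAt_max_sq (ε s : ℝ) :
    HasDerivAt (fun s => max (s - ε) 0 ^ 2) (2 * max (s - ε) 0) s := by
  rcases lt_trichotomy s ε with h | h | h
  · have : (fun s => max (s - ε) 0 ^ 2) =ᶠ[nhds s] fun _ => 0 := by
      filter_upwards [gt_mem_nhds h] with r hr
      rw [max_eq_right (by linarith)]; simp
    rw [max_eq_right (by linarith), mul_zero]
    exact (hasDerivAt_const s (0 : ℝ)).congr_of_eventuallyEq this
  · subst h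
    rw [sub_self, max_self, mul_zero, hasDerivAt_iff_isLittleO_nhds_zero]
    simp only [add_sub_cancel_left, sub_self, max_self, smul_zero, sub_zero]
    have h1 : (fun h : ℝ => max h 0 ^ 2) =O[nhds 0] fun h : ℝ => h ^ 2 := by
      refine Asymptotics.IsBigO.of_bound 1 (Filter.Eventually.of_forall fun h => ?_)
      rw [one_mul, norm_pow, norm_pow]
      gcongr
      rcases le_total h 0 with h' | h' <;> simp [h']
    have h2 := h1.trans_isLittleO
      (Asymptotics.isLittleO_pow_id (𝕜 := ℝ) (n := 2) (by norm_num))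
    simpa using h2
  · have : (fun s => max (s - ε) 0 ^ 2) =ᶠ[nhds s] fun s => (s - ε) ^ 2 := by
      filter_upwards [lt_mem_nhds h] with r hr
      rw [max_eq_left (by linarith)]
    rw [max_eq_left (by linarith)]
    have h1 : HasDerivAt (fun s : ℝ => (s - ε) ^ 2) (2 * (s - ε)) s := by
      have h := ((hasDerivAt_id s).sub_const ε).fun_pow 2
      simpa using h
    exact h1.congr_of_eventuallyEq this

lemma hasDerivAt_cutF {ε s : ℝ} (hs : 0 < s) : HasDerivAt (cutF ε) (cutD ε s) s := by
  have h := (hasDerivAt_max_sq ε s).div (hasDerivAt_id s) hs.ne'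
  have h2 : cutD ε s = (2 * max (s - ε) 0 * s - max (s - ε) 0 ^ 2 * 1) / s ^ 2 := by
    unfold cutD cutR
    field_simp
  rw [h2]
  exact h

lemma cutR_zero {ε s : ℝ} (h : s ≤ ε) : cutR ε s = 0 := by
  unfold cutR; rw [max_eq_right (by linarith)]; simp

lemma cutF_zero {ε s : ℝ} (h : s ≤ ε) : cutF ε s = 0 := by
  unfold cutF; rw [max_eq_right (by linarith)]; simp

lemma cutD_zero {ε s : ℝ} (h : s ≤ ε) : cutD ε s = 0 := by
  unfold cutD; rw [cutR_zero h]; simp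

lemma cutR_mem {ε s : ℝ} (hε : 0 < ε) (hs : 0 ≤ s) : 0 ≤ cutR ε s ∧ cutR ε s ≤ 1 := by
  unfold cutR
  refine ⟨by positivity, div_le_one_of_le₀ ?_ hs⟩
  exact max_le (by linarith) hs

lemma cutD_mem {ε s : ℝ} (hε : 0 < ε) (hs : 0 ≤ s) : 0 ≤ cutD ε s ∧ cutD ε s ≤ 1 := by
  obtain ⟨h1, h2⟩ := cutR_mem hε hs
  unfold cutD
  constructor <;> nlinarith

lemma cutF_mem {ε s : ℝ} (hε : 0 < ε) (hs : 0 ≤ s) : 0 ≤ cutF ε s ∧ cutF ε s ≤ s := by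
  have h0 : 0 ≤ max (s - ε) 0 := le_max_right _ _
  have h1 : max (s - ε) 0 ≤ s := max_le (by linarith) hs
  unfold cutF
  refine ⟨by positivity, div_le_of_le_mul₀ hs hs ?_⟩
  nlinarith

lemma continuousAt_cutR {ε s : ℝ} (hs : 0 < s) : ContinuousAt (cutR ε) s := by
  unfold cutR
  exact ContinuousAt.div (by fun_prop) continuousAt_id hs.ne'

lemma continuousAt_cutD {ε s : ℝ} (hs : 0 < s) : ContinuousAt (cutD ε) s := by
  have := continuousAt_cutR (ε := ε) hs
  unfold cutD
  fun_prop

lemma tendsto_cutR {s : ℝ} (hs : 0 < s) :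
    Filter.Tendsto (fun k : ℕ => cutR (1 / ((k : ℝ) + 1)) s) Filter.atTop (nhds 1) := by
  have h : Continuous fun ε : ℝ => cutR ε s := by unfold cutR; fun_prop
  have h2 := (h.tendsto 0).comp (tendsto_one_div_add_atTop_nhds_zero_nat (𝕜 := ℝ))
  have h3 : cutR 0 s = 1 := by
    unfold cutR
    rw [sub_zero, max_eq_left hs.le, div_self hs.ne']
  rw [h3] at h2
  exact h2

lemma tendsto_cutD {s : ℝ} (hs : 0 < s) :
    Filter.Tendsto (fun k : ℕ => cutD (1 / ((k : ℝ) + 1)) s) Filter.atTop (nhds 1) := by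
  have h := tendsto_cutR hs
  have := (h.const_mul 2).sub (h.pow 2)
  rw [show (2 : ℝ) * 1 - 1 ^ 2 = 1 by norm_num] at this
  exact this

lemma tendsto_cutF {s : ℝ} (hs : 0 < s) :
    Filter.Tendsto (fun k : ℕ => cutF (1 / ((k : ℝ) + 1)) s) Filter.atTop (nhds s) := by
  have h := ((tendsto_cutR hs).pow 2).mul_const s
  have h2 : ∀ k : ℕ, cutR (1 / ((k : ℝ) + 1)) s ^ 2 * s = cutF (1 / ((k : ℝ) + 1)) s := by
    intro k; unfold cutR cutF; field_simp
  simp only [h2, one_pow, one_mul] at h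
  exact h

lemma glue {Ω : Set E} {U : E → ℝ} (hc : IsCompact Ω) (hU : IsTorsionFn Ω U) {ε : ℝ}
    (hε : 0 < ε) {G : E → ℝ} (h1 : ContinuousOn G (interior Ω))
    (h2 : ∀ x, Ω.indicator U x < ε → G x = 0) : Integrable G := by
  have hcont : Continuous G := by
    rw [continuous_iff_continuousAt]
    intro x
    by_cases hx : x ∈ interior Ω
    · exact h1.continuousAt (isOpen_interior.mem_nhds hx)
    · have hx' : Ω.indicator U x < ε := by
        rw [← ext_pos_iff hc hU] at hx; linarith
      have : G =ᶠ[nhds x] fun _ => 0 := by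
        filter_upwards [(ext_continuous hU).continuousAt.eventually (gt_mem_nhds hx')] with y hy
        exact h2 y hy
      exact continuousAt_const.congr this.symm
  refine hcont.integrable_of_hasCompactSupport
    (HasCompactSupport.of_support_subset_isCompact hc ?_)
  intro x hx
  by_contra hxΩ
  exact hx (h2 x (by rw [Set.indicator_of_notMem hxΩ]; exact hε))

lemma cut_identity {Ω : Set E} {U : E → ℝ} (hc : IsCompact Ω) (hU : IsTorsionFn Ω U) {ε : ℝ}
    (hε : 0 < ε) :
    Integrable (fun x => cutD ε (Ω.indicator U x) * ‖gradient U x‖ ^ 2) ∧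
    ∫ x, cutD ε (Ω.indicator U x) * ‖gradient U x‖ ^ 2 =
      2 * ∫ x, cutF ε (Ω.indicator U x) := by
  set V := Ω.indicator U with hV
  let e : Fin n → E := fun i => EuclideanSpace.single i 1
  let u1 : Fin n → E → ℝ := fun i x => fderiv ℝ U x (e i)
  let u2 : Fin n → E → ℝ := fun i x => fderiv ℝ (u1 i) x (e i)
  have hfd : ContDiffOn ℝ 1 (fderiv ℝ U) (interior Ω) :=
    hU.2.1.fderiv_of_isOpen isOpen_interior (by norm_num)
  have hu1 : ∀ i, ContDiffOn ℝ 1 (u1 i) (interior Ω) := fun i => hfd.clm_apply contDiffOn_const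
  have hu2 : ∀ i, ContinuousOn (u2 i) (interior Ω) := fun i =>
    ((hu1 i).continuousOn_fderiv_of_isOpen isOpen_interior (by norm_num)).clm_apply
      continuousOn_const
  have hVc : Continuous V := ext_continuous hU
  have hVpos : ∀ x ∈ interior Ω, 0 < V x := fun x hx => (ext_pos_iff hc hU x).2 hx
  have hcF : ContinuousOn (fun x => cutF ε (V x)) (interior Ω) := fun x hx =>
    ((hasDerivAt_cutF (hVpos x hx)).continuousAt.comp hVc.continuousAt).continuousWithinAt
  have hcD : ContinuousOn (fun x => cutD ε (V x)) (interior Ω) := fun x hx =>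
    ((continuousAt_cutD (hVpos x hx)).comp hVc.continuousAt).continuousWithinAt
  let X : Fin n → E → ℝ := fun i x => cutF ε (V x) * u1 i x
  let D : Fin n → E → ℝ := fun i x => cutD ε (V x) * u1 i x ^ 2 + cutF ε (V x) * u2 i x
  have hXint : ∀ i, Integrable (X i) := fun i =>
    glue hc hU hε (hcF.mul (hu1 i).continuousOn) fun x hx => by
      simp only [X]; rw [cutF_zero hx.le, zero_mul]
  have hDint : ∀ i, Integrable (D i) := fun i =>
    glue hc hU hε ((hcD.mul ((hu1 i).continuousOn.pow 2)).add (hcF.mul (hu2 i))) fun x hx => by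
      simp only [D]; rw [cutF_zero hx.le, cutD_zero hx.le]; simp
  have hder : ∀ i x, DifferentiableAt ℝ (X i) x ∧ fderiv ℝ (X i) x (e i) = D i x := by
    intro i x
    by_cases hx : x ∈ interior Ω
    · have hloc : X i =ᶠ[nhds x] fun y => cutF ε (U y) * u1 i y := by
        filter_upwards [isOpen_interior.mem_nhds hx] with y hy
        simp only [X, hV]
        rw [Set.indicator_of_mem (interior_subset hy)]
      have hVx : V x = U x := Set.indicator_of_mem (interior_subset hx) U
      have hdU : HasFDerivAt U (fderiv ℝ U x) x :=
        ((hU.2.1.differentiableOn (by norm_num)).differentiableAt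
          (isOpen_interior.mem_nhds hx)).hasFDerivAt
      have hdu1 : HasFDerivAt (u1 i) (fderiv ℝ (u1 i) x) x :=
        (((hu1 i).differentiableOn (by norm_num)).differentiableAt
          (isOpen_interior.mem_nhds hx)).hasFDerivAt
      have hφ : HasDerivAt (cutF ε) (cutD ε (U x)) (U x) :=
        hasDerivAt_cutF (by rw [← hVx]; exact hVpos x hx)
      have h1 := (hφ.comp_hasFDerivAt x hdU).mul hdu1
      have h2 := h1.congr_of_eventuallyEq hloc
      refine ⟨h2.differentiableAt, ?_⟩
      rw [h2.fderiv]
      simp only [D, u2, hVx]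
      simp
      simp only [u1]
      ring
    · have hx' : V x < ε := by
        have := (ext_pos_iff hc hU x).not.2 hx
        linarith
      have : X i =ᶠ[nhds x] fun _ => 0 := by
        filter_upwards [hVc.continuousAt.eventually (gt_mem_nhds hx')] with y hy
        simp only [X]; rw [cutF_zero (le_of_lt hy), zero_mul]
      refine ⟨(differentiableAt_const (0 : ℝ)).congr_of_eventuallyEq this, ?_⟩
      rw [this.fderiv_eq]
      simp only [D]
      rw [cutF_zero hx'.le, cutD_zero hx'.le]; simp
  have hzero : ∀ i, ∫ x, D i x = 0 := by
    intro i
    have h := integral_mul_fderiv_eq_neg_fderiv_mul_of_integrable (μ := (volume : Measure E))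
      (f := fun _ => (1 : ℝ)) (g := X i) (v := e i) (by simp)
      (by simpa [(hder i _).2] using hDint i) (by simpa using hXint i)
      (fun x _ => differentiableAt_const _) (fun x _ => (hder i x).1)
    simpa [(hder i _).2] using h
  have hgrad : ∀ x, ‖gradient U x‖ ^ 2 = ∑ i, u1 i x ^ 2 := by
    intro x
    rw [EuclideanSpace.norm_sq_eq]
    refine Finset.sum_congr rfl fun i _ => ?_
    have : gradient U x i = u1 i x := by
      have h1 : inner ℝ (gradient U x) (e i) = fderiv ℝ U x (e i) := by
        simp [gradient]
      have h2 : inner ℝ (gradient U x) (e i) = gradient U x i := by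
        rw [EuclideanSpace.inner_single_right]; simp
      simp only [u1]
      rw [← h1, h2]
    rw [this]; simp
  have hFint : Integrable fun x => cutF ε (V x) :=
    glue hc hU hε hcF fun x hx => cutF_zero hx.le
  have hsum : ∀ x, cutD ε (V x) * ‖gradient U x‖ ^ 2 = (∑ i, D i x) + 2 * cutF ε (V x) := by
    intro x
    by_cases hx : x ∈ interior Ω
    · have hl : ∑ i, u2 i x = -2 := hU.2.2.1 x hx
      simp only [D]
      rw [Finset.sum_add_distrib, ← Finset.mul_sum, ← Finset.mul_sum, hl, hgrad]
      ring
    · have hx' : V x < ε := by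
        have := (ext_pos_iff hc hU x).not.2 hx
        linarith
      simp only [D]
      rw [cutF_zero hx'.le, cutD_zero hx'.le]; simp
  have hsumint : Integrable fun x => ∑ i, D i x := integrable_finsetSum _ fun i _ => hDint i
  have hfun : (fun x => cutD ε (V x) * ‖gradient U x‖ ^ 2) =
      fun x => (∑ i, D i x) + 2 * cutF ε (V x) := funext hsum
  rw [hfun]
  refine ⟨hsumint.add (hFint.const_mul 2), ?_⟩
  rw [integral_add hsumint (hFint.const_mul 2), integral_finsetSum _ fun i _ => hDint i,
    integral_const_mul]
  simp [hzero]

lemma torsion_eq {Ω : Set E} {U : E → ℝ} (hc : IsCompact Ω) (hconv : Convex ℝ Ω)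
    (hU : IsTorsionFn Ω U) : torsion Ω U = 2 * ∫ x, Ω.indicator U x := by
  set V := Ω.indicator U with hV
  have hae : (interior Ω : Set E) =ᵐ[volume] Ω :=
    interior_ae_eq_of_null_frontier (hconv.addHaar_frontier volume)
  have hT : torsion Ω U = ∫ x in interior Ω, ‖gradient U x‖ ^ 2 := by
    unfold torsion
    exact (setIntegral_congr_set hae).symm
  have hVint : Integrable V := ext_integrable hc hU
  have hVpos : ∀ x ∈ interior Ω, 0 < V x := fun x hx => (ext_pos_iff hc hU x).2 hx
  have hV0 : ∀ x, 0 ≤ V x := ext_nonneg hc hU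
  have hVzero : ∀ x, x ∉ interior Ω → V x = 0 := fun x hx =>
    le_antisymm (not_lt.1 ((ext_pos_iff hc hU x).not.2 hx)) (hV0 x)
  set μ := (volume : Measure E).restrict (interior Ω) with hμ
  let ε : ℕ → ℝ := fun k => 1 / ((k : ℝ) + 1)
  have hε : ∀ k, 0 < ε k := fun k => by positivity
  let g : E → ℝ := fun x => ‖gradient U x‖ ^ 2
  let G : ℕ → E → ℝ := fun k x => cutD (ε k) (V x) * g x
  have hGint : ∀ k, Integrable (G k) := fun k => (cut_identity hc hU (hε k)).1
  have hGval : ∀ k, ∫ x, G k x ∂μ = 2 * ∫ x, cutF (ε k) (V x) ∂μ := by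
    intro k
    have h := (cut_identity hc hU (hε k)).2
    rw [setIntegral_eq_integral_of_forall_compl_eq_zero,
      setIntegral_eq_integral_of_forall_compl_eq_zero]
    · exact h
    · intro x hx
      rw [cutF_zero]; rw [hVzero x hx]; exact (hε k).le
    · intro x hx
      simp only [G]
      rw [cutD_zero, zero_mul]; rw [hVzero x hx]; exact (hε k).le
  have hmem : ∀ᵐ x ∂μ, x ∈ interior Ω := ae_restrict_mem isOpen_interior.measurableSet
  have hlim : ∀ᵐ x ∂μ, Filter.Tendsto (fun k => G k x) Filter.atTop (nhds (g x)) := by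
    filter_upwards [hmem] with x hx
    have := (tendsto_cutD (hVpos x hx)).mul_const (g x)
    rw [one_mul] at this
    exact this
  have hlimF : ∀ᵐ x ∂μ, Filter.Tendsto (fun k => cutF (ε k) (V x)) Filter.atTop
      (nhds (V x)) := by
    filter_upwards [hmem] with x hx
    exact tendsto_cutF (hVpos x hx)
  have hgm : AEStronglyMeasurable g μ :=
    aestronglyMeasurable_of_tendsto_ae Filter.atTop
      (fun k => (hGint k).aestronglyMeasurable.restrict) hlim
  have hG0 : ∀ k x, 0 ≤ G k x := fun k x =>
    mul_nonneg (cutD_mem (hε k) (hV0 x)).1 (sq_nonneg _)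
  have hFm : ∀ k, AEStronglyMeasurable (fun x => cutF (ε k) (V x)) μ := by
    intro k
    refine ContinuousOn.aestronglyMeasurable (fun x hx => ?_) isOpen_interior.measurableSet
    exact ((hasDerivAt_cutF (hVpos x hx)).continuousAt.comp
      (ext_continuous hU).continuousAt).continuousWithinAt
  have hFint : ∀ k, Integrable (fun x => cutF (ε k) (V x)) μ := fun k =>
    (hVint.restrict (s := interior Ω)).mono' (hFm k) (Filter.Eventually.of_forall fun x => by
      rw [Real.norm_of_nonneg (cutF_mem (hε k) (hV0 x)).1]
      exact (cutF_mem (hε k) (hV0 x)).2)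
  have hgint : Integrable g μ := by
    refine ⟨hgm, ?_⟩
    rw [hasFiniteIntegral_iff_ofReal (Filter.Eventually.of_forall fun x => sq_nonneg _)]
    have h1 : ∫⁻ x, ENNReal.ofReal (g x) ∂μ ≤
        Filter.liminf (fun k => ∫⁻ x, ENNReal.ofReal (G k x) ∂μ) Filter.atTop := by
      refine le_trans (le_of_eq ?_) (lintegral_liminf_le' fun k =>
        (hGint k).aestronglyMeasurable.restrict.aemeasurable.ennreal_ofReal)
      refine lintegral_congr_ae ?_
      filter_upwards [hlim] with x hx
      exact (((ENNReal.continuous_ofReal.tendsto _).comp hx).liminf_eq).symm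
    have h2 : ∀ k, ∫⁻ x, ENNReal.ofReal (G k x) ∂μ ≤ ENNReal.ofReal (2 * ∫ x, V x ∂μ) := by
      intro k
      rw [← ofReal_integral_eq_lintegral_ofReal (hGint k).restrict
        (Filter.Eventually.of_forall (hG0 k)), hGval k]
      refine ENNReal.ofReal_le_ofReal (mul_le_mul_of_nonneg_left ?_ (by norm_num))
      exact integral_mono (hFint k) hVint.restrict fun x => (cutF_mem (hε k) (hV0 x)).2
    have h3 : Filter.liminf (fun k => ∫⁻ x, ENNReal.ofReal (G k x) ∂μ) Filter.atTop ≤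
        ENNReal.ofReal (2 * ∫ x, V x ∂μ) :=
      (Filter.liminf_le_liminf (Filter.Eventually.of_forall h2)).trans (by simp)
    exact (h1.trans h3).trans_lt ENNReal.ofReal_lt_top
  have l1 : Filter.Tendsto (fun k => ∫ x, G k x ∂μ) Filter.atTop (nhds (∫ x, g x ∂μ)) := by
    refine tendsto_integral_of_dominated_convergence g
      (fun k => (hGint k).aestronglyMeasurable.restrict) hgint
      (fun k => Filter.Eventually.of_forall fun x => ?_) hlim
    rw [Real.norm_of_nonneg (hG0 k x)]
    exact mul_le_of_le_one_left (sq_nonneg _) (cutD_mem (hε k) (hV0 x)).2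
  have l2 : Filter.Tendsto (fun k => ∫ x, cutF (ε k) (V x) ∂μ) Filter.atTop
      (nhds (∫ x, V x ∂μ)) := by
    refine tendsto_integral_of_dominated_convergence V hFm hVint.restrict
      (fun k => Filter.Eventually.of_forall fun x => ?_) hlimF
    rw [Real.norm_of_nonneg (cutF_mem (hε k) (hV0 x)).1]
    exact (cutF_mem (hε k) (hV0 x)).2
  have l3 : ∫ x, g x ∂μ = 2 * ∫ x, V x ∂μ := by
    refine tendsto_nhds_unique l1 ?_
    simp_rw [hGval]
    exact l2.const_mul 2
  rw [hT, ← setIntegral_eq_integral_of_forall_compl_eq_zero (s := interior Ω) (f := V)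
    (fun x hx => hVzero x hx)]
  exact l3

end Rigidity

/-! ### The one-dimensional Borell-Brascamp-Lieb inequality with its equality case -/

/-- Nonnegative continuous compactly supported functions, positive exactly on a nonempty
convex set. -/
structure NiceFn {X : Type*} [TopologicalSpace X] [AddCommGroup X] [Module ℝ X]
    (f : X → ℝ) : Prop where
  cont : Continuous f
  supp : HasCompactSupport f
  nonneg : ∀ x, 0 ≤ f x
  conv : Convex ℝ {x | 0 < f x}
  ne : ∃ x, 0 < f x

lemma pow_jensen {u v α β t : ℝ} (k : ℕ) (hu : 0 < u) (hv : 0 < v) (hα : 0 < α) (hβ : 0 < β)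
    (ht0 : 0 ≤ t) (ht1 : t ≤ 1) :
    ((1 - t) * α + t * β) ^ (k + 1) ≤
      ((1 - t) * u + t * v) ^ k * ((1 - t) * (α ^ (k + 1) / u ^ k) + t * (β ^ (k + 1) / v ^ k)) ∧
    (1 ≤ k → 0 < t → t < 1 → ((1 - t) * u + t * v) ^ k *
        ((1 - t) * (α ^ (k + 1) / u ^ k) + t * (β ^ (k + 1) / v ^ k)) ≤
          ((1 - t) * α + t * β) ^ (k + 1) → α * v = β * u) := by
  set S := (1 - t) * u + t * v with hS
  have hSpos : 0 < S := by
    rcases ht0.eq_or_lt with h | h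
    · rw [hS, ← h]; simpa using hu
    · have : 0 ≤ (1 - t) * u := mul_nonneg (by linarith) hu.le
      have : 0 < t * v := mul_pos h hv
      linarith
  have hω1 : 0 ≤ (1 - t) * u / S := div_nonneg (mul_nonneg (by linarith) hu.le) hSpos.le
  have hω2 : 0 ≤ t * v / S := div_nonneg (mul_nonneg ht0 hv.le) hSpos.le
  have hω : (1 - t) * u / S + t * v / S = 1 := by
    rw [← add_div, ← hS, div_self hSpos.ne']
  have e1 : (1 - t) * u / S * (α / u) + t * v / S * (β / v) = ((1 - t) * α + t * β) / S := by
    field_simp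
  have e2 : S ^ (k + 1) * ((1 - t) * u / S * (α / u) ^ (k + 1) + t * v / S * (β / v) ^ (k + 1)) =
      S ^ k * ((1 - t) * (α ^ (k + 1) / u ^ k) + t * (β ^ (k + 1) / v ^ k)) := by
    rw [div_pow, div_pow, pow_succ S k, pow_succ u k, pow_succ v k]
    field_simp
  have e3 : S ^ (k + 1) * (((1 - t) * α + t * β) / S) ^ (k + 1) =
      ((1 - t) * α + t * β) ^ (k + 1) := by
    rw [← mul_pow, mul_div_cancel₀ _ hSpos.ne']
  have hm1 : α / u ∈ Set.Ici (0 : ℝ) := (div_pos hα hu).le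
  have hm2 : β / v ∈ Set.Ici (0 : ℝ) := (div_pos hβ hv).le
  constructor
  · have h := (convexOn_pow (k + 1)).2 hm1 hm2 hω1 hω2 hω
    simp only [smul_eq_mul] at h
    rw [e1] at h
    rw [← e2, ← e3]
    exact mul_le_mul_of_nonneg_left h (by positivity)
  · intro hk h0 h1 hle
    by_contra hne
    have hne' : α / u ≠ β / v := fun h => hne (by rwa [div_eq_div_iff hu.ne' hv.ne'] at h)
    have h := (strictConvexOn_pow (show 2 ≤ k + 1 by omega)).2 hm1 hm2 hne'
      (div_pos (mul_pos (by linarith) hu) hSpos) (div_pos (mul_pos h0 hv) hSpos) hω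
    simp only [smul_eq_mul] at h
    rw [e1] at h
    rw [← e2, ← e3] at hle
    exact absurd (lt_of_lt_of_le (mul_lt_mul_of_pos_left h (by positivity)) hle) (lt_irrefl _)

/-- cumulative distribution function -/
lemma NiceFn.cdf {f : ℝ → ℝ} (hf : NiceFn f) :
    ∃ (a b : ℝ) (Φ : ℝ → ℝ), a < b ∧ (∀ s, 0 < f s ↔ s ∈ Set.Ioo a b) ∧
      (∀ s, HasDerivAt Φ (f s) s) ∧ Φ a = 0 ∧ Φ b = ∫ s, f s ∧
        StrictMonoOn Φ (Set.Icc a b) := by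
  set P := {x | 0 < f x} with hP
  have hopen : IsOpen P := isOpen_lt continuous_const hf.cont
  have hbdd : Bornology.IsBounded P :=
    hf.supp.isCompact.isBounded.subset fun x hx => subset_tsupport f (ne_of_gt hx)
  have hne : P.Nonempty := hf.ne
  have hbb : BddBelow P := hbdd.bddBelow
  have hba : BddAbove P := hbdd.bddAbove
  set a := sInf P with ha
  set b := sSup P with hb
  have hPab : P = Set.Ioo a b := by
    apply Set.Subset.antisymm
    · intro x hx
      constructor
      · refine lt_of_le_of_ne (csInf_le hbb hx) fun h => ?_
        have hx' : P ∈ nhds x := hopen.mem_nhds hx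
        obtain ⟨l, hl, hlP⟩ := exists_Ioc_subset_of_mem_nhds hx' ⟨x - 1, by linarith⟩
        have := csInf_le hbb (hlP (show (l + x) / 2 ∈ Set.Ioc l x from
          ⟨by linarith, by linarith⟩))
        linarith
      · refine lt_of_le_of_ne (le_csSup hba hx) fun h => ?_
        have hx' : P ∈ nhds x := hopen.mem_nhds hx
        obtain ⟨l, hl, hlP⟩ := exists_Ico_subset_of_mem_nhds hx' ⟨x + 1, by linarith⟩
        have := le_csSup hba (hlP (show (l + x) / 2 ∈ Set.Ico x l from
          ⟨by linarith, by linarith⟩))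
        linarith
    · intro x hx
      obtain ⟨y, hy, hyx⟩ := exists_lt_of_csInf_lt hne hx.1
      obtain ⟨z, hz, hxz⟩ := exists_lt_of_lt_csSup hne hx.2
      exact hf.conv.ordConnected.out hy hz ⟨hyx.le, hxz.le⟩
  have hab : a < b := by
    obtain ⟨x, hx⟩ := hne
    rw [hPab] at hx
    exact hx.1.trans hx.2
  have hiff : ∀ s, 0 < f s ↔ s ∈ Set.Ioo a b := fun s => by
    rw [← hPab]; exact Iff.rfl
  have hder : ∀ s, HasDerivAt (fun u => ∫ x in a..u, f x) (f s) s := fun s =>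
    intervalIntegral.integral_hasDerivAt_right (hf.cont.intervalIntegrable _ _)
      (hf.cont.stronglyMeasurableAtFilter _ _) hf.cont.continuousAt
  refine ⟨a, b, fun u => ∫ x in a..u, f x, hab, hiff, hder, by simp, ?_, ?_⟩
  · simp only
    rw [intervalIntegral.integral_of_le hab.le, integral_Ioc_eq_integral_Ioo]
    refine setIntegral_eq_integral_of_forall_compl_eq_zero fun x hx => ?_
    exact le_antisymm (not_lt.1 ((hiff x).not.2 hx)) (hf.nonneg x)
  · refine strictMonoOn_of_deriv_pos (convex_Icc a b)
      (fun s _ => (hder s).continuousAt.continuousWithinAt) fun s hs => ?_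
    rw [interior_Icc] at hs
    rw [(hder s).deriv]
    exact (hiff s).2 hs

lemma NiceFn.integral_pos1 {f : ℝ → ℝ} (hf : NiceFn f) : 0 < ∫ s, f s := by
  obtain ⟨a, b, Φ, hab, -, -, h0, h1, hm⟩ := hf.cdf
  rw [← h1, ← h0]
  exact hm ⟨le_rfl, hab.le⟩ ⟨hab.le, le_rfl⟩ hab

/-- monotone transport map -/
lemma NiceFn.transport {f g : ℝ → ℝ} (hf : NiceFn f) (hg : NiceFn g) :
    ∃ (a b a' b' : ℝ) (S : ℝ → ℝ), (∀ s, 0 < f s ↔ s ∈ Set.Ioo a b) ∧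
      (∀ s, 0 < g s ↔ s ∈ Set.Ioo a' b') ∧ S '' Set.Ioo a b = Set.Ioo a' b' ∧
      StrictMonoOn S (Set.Ioo a b) ∧
      ∀ s ∈ Set.Ioo a b, HasDerivAt S ((∫ x, g x) / (∫ x, f x) * f s / g (S s)) s := by
  obtain ⟨a, b, Φ, hab, hfi, hΦ, hΦa, hΦb, hΦm⟩ := hf.cdf
  obtain ⟨a', b', Ψ, hab', hgi, hΨ, hΨa, hΨb, hΨm⟩ := hg.cdf
  have hA := hf.integral_pos1
  have hB := hg.integral_pos1
  set A := ∫ x, f x with hAdef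
  set B := ∫ x, g x with hBdef
  have hΦc : Continuous Φ := continuous_iff_continuousAt.2 fun s => (hΦ s).continuousAt
  have hΨc : Continuous Ψ := continuous_iff_continuousAt.2 fun s => (hΨ s).continuousAt
  have hex : ∀ s ∈ Set.Ioo a b, ∃ y ∈ Set.Ioo a' b', Ψ y = B / A * Φ s := by
    intro s hs
    have h1 : Φ a < Φ s := hΦm ⟨le_rfl, hab.le⟩ ⟨hs.1.le, hs.2.le⟩ hs.1
    have h2 : Φ s < Φ b := hΦm ⟨hs.1.le, hs.2.le⟩ ⟨hab.le, le_rfl⟩ hs.2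
    rw [hΦa] at h1
    rw [hΦb] at h2
    have := intermediate_value_Ioo hab'.le hΨc.continuousOn
    obtain ⟨y, hy, hyv⟩ := this (show B / A * Φ s ∈ Set.Ioo (Ψ a') (Ψ b') by
      rw [hΨa, hΨb]
      refine ⟨by positivity, ?_⟩
      calc B / A * Φ s < B / A * A := mul_lt_mul_of_pos_left h2 (by positivity)
        _ = B := by field_simp)
    exact ⟨y, hy, hyv⟩
  have hex' : ∀ y ∈ Set.Ioo a' b', ∃ s ∈ Set.Ioo a b, Φ s = A / B * Ψ y := by
    intro s hs
    have h1 : Ψ a' < Ψ s := hΨm ⟨le_rfl, hab'.le⟩ ⟨hs.1.le, hs.2.le⟩ hs.1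
    have h2 : Ψ s < Ψ b' := hΨm ⟨hs.1.le, hs.2.le⟩ ⟨hab'.le, le_rfl⟩ hs.2
    rw [hΨa] at h1
    rw [hΨb] at h2
    have := intermediate_value_Ioo hab.le hΦc.continuousOn
    obtain ⟨y, hy, hyv⟩ := this (show A / B * Ψ s ∈ Set.Ioo (Φ a) (Φ b) by
      rw [hΦa, hΦb]
      refine ⟨by positivity, ?_⟩
      calc A / B * Ψ s < A / B * B := mul_lt_mul_of_pos_left h2 (by positivity)
        _ = A := by field_simp)
    exact ⟨y, hy, hyv⟩
  choose! S hSm hSv using hex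
  have hmono : StrictMonoOn S (Set.Ioo a b) := by
    intro x hx y hy hxy
    by_contra! hle
    have h1 : Ψ (S y) ≤ Ψ (S x) := hΨm.monotoneOn (Set.Ioo_subset_Icc_self (hSm y hy))
      (Set.Ioo_subset_Icc_self (hSm x hx)) hle
    rw [hSv x hx, hSv y hy] at h1
    have h2 : Φ x < Φ y :=
      hΦm (Set.Ioo_subset_Icc_self hx) (Set.Ioo_subset_Icc_self hy) hxy
    have := mul_lt_mul_of_pos_left h2 (show 0 < B / A by positivity)
    linarith
  have himg : S '' Set.Ioo a b = Set.Ioo a' b' := by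
    apply Set.Subset.antisymm
    · rintro _ ⟨s, hs, rfl⟩
      exact hSm s hs
    · intro y hy
      obtain ⟨s, hs, hsv⟩ := hex' y hy
      refine ⟨s, hs, hΨm.injOn (Set.Ioo_subset_Icc_self (hSm s hs))
        (Set.Ioo_subset_Icc_self hy) ?_⟩
      rw [hSv s hs, hsv]
      field_simp
  refine ⟨a, b, a', b', S, hfi, hgi, himg, hmono, fun s hs => ?_⟩
  have hnh : Set.Ioo a b ∈ nhds s := isOpen_Ioo.mem_nhds hs
  have hSc : ContinuousAt S s := hmono.continuousAt_of_image_mem_nhds hnh (by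
    rw [himg]; exact isOpen_Ioo.mem_nhds (hSm s hs))
  have hgS : 0 < g (S s) := (hgi _).2 (hSm s hs)
  -- `S` is, near `s`, a local inverse of `Ψ` composed with `Φ`
  have hstrict : HasStrictDerivAt Ψ (g (S s)) (S s) :=
    hasStrictDerivAt_of_hasDerivAt_of_continuousAt (Filter.Eventually.of_forall hΨ)
      hg.cont.continuousAt
  have hL := (hstrict.to_localInverse hgS.ne').hasDerivAt
  have hli := (hstrict.hasStrictFDerivAt_equiv hgS.ne').eventually_left_inverse
  have hcomp : HasDerivAt (fun r => hstrict.localInverse Ψ (g (S s)) (S s) hgS.ne' (B / A * Φ r))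
      ((g (S s))⁻¹ * (B / A * f s)) s := by
    have h1 : HasDerivAt (fun r => B / A * Φ r) (B / A * f s) s := (hΦ s).const_mul _
    have hL' : HasDerivAt (hstrict.localInverse Ψ (g (S s)) (S s) hgS.ne') (g (S s))⁻¹
        (B / A * Φ s) := by rw [← hSv s hs]; exact hL
    exact hL'.comp s h1
  have heq : S =ᶠ[nhds s]
      fun r => hstrict.localInverse Ψ (g (S s)) (S s) hgS.ne' (B / A * Φ r) := by
    filter_upwards [hSc.eventually hli, hnh] with r hr hrm
    rw [← hSv r hrm]
    exact hr.symm
  have := hcomp.congr_of_eventuallyEq heq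
  rw [show B / A * f s / g (S s) = (g (S s))⁻¹ * (B / A * f s) by ring]
  exact this

lemma exists_root {x : ℝ} (hx : 0 < x) {k : ℕ} (hk : 1 ≤ k) : ∃ u : ℝ, 0 < u ∧ u ^ k = x :=
  ⟨x ^ ((k : ℝ)⁻¹), Real.rpow_pos_of_pos hx _,
    Real.rpow_inv_natCast_pow hx.le (by omega)⟩

/-- One-dimensional Borell-Brascamp-Lieb inequality, with equality case. -/
lemma bbl_one {k : ℕ} (hk : 1 ≤ k) {t : ℝ} (ht0 : 0 ≤ t) (ht1 : t ≤ 1) {f g h : ℝ → ℝ}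
    (hf : NiceFn f) (hg : NiceFn g) (hc : Continuous h) (hi : Integrable h) (hn : ∀ x, 0 ≤ h x)
    (H : ∀ a b u v : ℝ, 0 < u → 0 < v → f a = u ^ k → g b = v ^ k →
      ((1 - t) * u + t * v) ^ k ≤ h ((1 - t) * a + t * b))
    {α β : ℝ} (hα : 0 < α) (hβ : 0 < β) (hαf : α ^ (k + 1) = ∫ x, f x)
    (hβg : β ^ (k + 1) = ∫ x, g x) :
    ((1 - t) * α + t * β) ^ (k + 1) ≤ ∫ x, h x ∧
    (0 < t → t < 1 → ∫ x, h x ≤ ((1 - t) * α + t * β) ^ (k + 1) →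
      ∃ c, ∀ s, g (β / α * s + c) = (β / α) ^ k * f s) := by
  obtain ⟨a, b, a', b', S, hfi, hgi, himg, hmono, hS⟩ := hf.transport hg
  rw [← hαf, ← hβg] at hS
  have hSm : ∀ s ∈ Set.Ioo a b, S s ∈ Set.Ioo a' b' := fun s hs => himg ▸ ⟨s, hs, rfl⟩
  set D := ((1 - t) * α + t * β) ^ (k + 1) with hD
  let S' : ℝ → ℝ := fun s => β ^ (k + 1) / α ^ (k + 1) * f s / g (S s)
  let z : ℝ → ℝ := fun s => (1 - t) * s + t * S s
  let z' : ℝ → ℝ := fun s => (1 - t) + t * S' s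
  have hS'pos : ∀ s ∈ Set.Ioo a b, 0 < S' s := fun s hs => by
    have h1 : 0 < f s := (hfi s).2 hs
    have h2 : 0 < g (S s) := (hgi _).2 (hSm s hs)
    simp only [S']
    positivity
  have hz'pos : ∀ s ∈ Set.Ioo a b, 0 < z' s := fun s hs => by
    have h1 := hS'pos s hs
    simp only [z']
    rcases ht0.eq_or_lt with h | h
    · rw [← h]; norm_num
    · have := mul_pos h h1
      linarith
  have hz : ∀ s ∈ Set.Ioo a b, HasDerivWithinAt z (z' s) (Set.Ioo a b) s := fun s hs => by
    have h1 := ((hasDerivAt_id s).const_mul (1 - t)).fun_add ((hS s hs).const_mul t)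
    rw [mul_one] at h1
    exact h1.hasDerivWithinAt
  have hzinj : Set.InjOn z (Set.Ioo a b) := by
    have : StrictMonoOn z (Set.Ioo a b) := by
      intro x hx y hy hxy
      have h1 := hmono hx hy hxy
      simp only [z]
      rcases ht0.eq_or_lt with h | h
      · rw [← h]; simpa using hxy
      · have h2 := mul_lt_mul_of_pos_left h1 h
        have h3 := mul_le_mul_of_nonneg_left hxy.le (show 0 ≤ 1 - t by linarith)
        linarith
    exact this.injOn
  have hcv := integral_image_eq_integral_abs_deriv_smul measurableSet_Ioo hz hzinj h
  have hcvi := (integrableOn_image_iff_integrableOn_abs_deriv_smul measurableSet_Ioo hz hzinj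
    h).1 hi.integrableOn
  have hup : ∫ s in Set.Ioo a b, |z' s| • h (z s) ≤ ∫ x, h x := by
    rw [← hcv]
    exact setIntegral_le_integral hi (Filter.Eventually.of_forall hn)
  -- pointwise inequality
  have hpt : ∀ s ∈ Set.Ioo a b, D / α ^ (k + 1) * f s ≤ |z' s| • h (z s) ∧
      (0 < t → t < 1 → |z' s| • h (z s) ≤ D / α ^ (k + 1) * f s →
        S' s = β / α ∧ g (S s) = (β / α) ^ k * f s) := by
    intro s hs
    have hfs : 0 < f s := (hfi s).2 hs
    have hgs : 0 < g (S s) := (hgi _).2 (hSm s hs)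
    obtain ⟨u, hu, huk⟩ := exists_root hfs hk
    obtain ⟨v, hv, hvk⟩ := exists_root hgs hk
    have hh := H s (S s) u v hu hv huk.symm hvk.symm
    obtain ⟨hJ, hJe⟩ := pow_jensen k hu hv hα hβ ht0 ht1
    rw [abs_of_pos (hz'pos s hs), smul_eq_mul]
    have hz'e : α ^ (k + 1) * z' s = f s *
        ((1 - t) * (α ^ (k + 1) / u ^ k) + t * (β ^ (k + 1) / v ^ k)) := by
      simp only [z', S']
      rw [← huk, ← hvk]
      field_simp
    have hα' : 0 < α ^ (k + 1) := by positivity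
    have hchain : ((1 - t) * u + t * v) ^ k *
        ((1 - t) * (α ^ (k + 1) / u ^ k) + t * (β ^ (k + 1) / v ^ k)) * f s ≤
          α ^ (k + 1) * (z' s * h (z s)) := by
      have h1 := mul_le_mul_of_nonneg_left hh
        (show 0 ≤ α ^ (k + 1) * z' s from (mul_pos hα' (hz'pos s hs)).le)
      calc _ = α ^ (k + 1) * z' s * ((1 - t) * u + t * v) ^ k := by rw [hz'e]; ring
        _ ≤ _ := h1
        _ = _ := by simp only [z]; ring
    constructor
    · rw [div_mul_eq_mul_div, div_le_iff₀ hα']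
      have := mul_le_mul_of_nonneg_right hJ hfs.le
      linarith
    · intro h0 h1 hle
      rw [div_mul_eq_mul_div, le_div_iff₀ hα'] at hle
      have h2 : ((1 - t) * u + t * v) ^ k *
        ((1 - t) * (α ^ (k + 1) / u ^ k) + t * (β ^ (k + 1) / v ^ k)) * f s ≤ D * f s := by
        linarith
      have h3 := hJe hk h0 h1 (le_of_mul_le_mul_right h2 hfs)
      have hv' : v = β / α * u := by field_simp; linarith
      have hg' : g (S s) = (β / α) ^ k * f s := by rw [← hvk, ← huk, hv', mul_pow]
      refine ⟨?_, hg'⟩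
      simp only [S']
      rw [hg', div_pow, pow_succ, pow_succ]
      field_simp
  have hfint : Integrable f := hf.cont.integrable_of_hasCompactSupport hf.supp
  have hfI : ∫ s in Set.Ioo a b, f s = α ^ (k + 1) := by
    rw [hαf]
    refine setIntegral_eq_integral_of_forall_compl_eq_zero fun x hx => ?_
    exact le_antisymm (not_lt.1 ((hfi x).not.2 hx)) (hf.nonneg x)
  have hlow : ∫ s in Set.Ioo a b, D / α ^ (k + 1) * f s = D := by
    rw [integral_const_mul, hfI]
    field_simp
  have hmid : D ≤ ∫ s in Set.Ioo a b, |z' s| • h (z s) := by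
    rw [← hlow]
    exact setIntegral_mono_on (hfint.const_mul _).integrableOn hcvi measurableSet_Ioo
      fun s hs => (hpt s hs).1
  refine ⟨hmid.trans hup, fun h0 h1 hle => ?_⟩
  have hzero : ∫ s in Set.Ioo a b, (|z' s| • h (z s) - D / α ^ (k + 1) * f s) = 0 := by
    rw [integral_sub hcvi (hfint.const_mul _).integrableOn, hlow]
    linarith
  have hae := (setIntegral_eq_zero_iff_of_nonneg_ae
    (by
      filter_upwards [ae_restrict_mem measurableSet_Ioo] with s hs
      exact sub_nonneg.2 (hpt s hs).1)
    (hcvi.sub (hfint.const_mul _).integrableOn)).1 hzero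
  have hSc : ContinuousOn S (Set.Ioo a b) := fun s hs => (hS s hs).continuousAt.continuousWithinAt
  have hS'c : ContinuousOn S' (Set.Ioo a b) := by
    refine ContinuousOn.div (by have := hf.cont; fun_prop) (hg.cont.comp_continuousOn hSc) ?_
    exact fun s hs => ((hgi _).2 (hSm s hs)).ne'
  have hcc : ContinuousOn (fun s => |z' s| • h (z s) - D / α ^ (k + 1) * f s)
      (Set.Ioo a b) := by
    have hz'c : ContinuousOn z' (Set.Ioo a b) := by
      simp only [z']; fun_prop
    have hzc : ContinuousOn z (Set.Ioo a b) := by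
      simp only [z]; fun_prop
    have hfc := hf.cont
    exact (hz'c.abs.smul (hc.comp_continuousOn hzc)).sub (by fun_prop)
  have heq := MeasureTheory.Measure.eqOn_open_of_ae_eq hae isOpen_Ioo hcc continuousOn_const
  have hfin : ∀ s ∈ Set.Ioo a b, S' s = β / α ∧ g (S s) = (β / α) ^ k * f s := fun s hs => by
    have h2 : |z' s| • h (z s) - D / α ^ (k + 1) * f s = 0 := heq hs
    exact (hpt s hs).2 h0 h1 (by linarith)
  -- `S` is affine
  obtain ⟨s0, hs0⟩ : (Set.Ioo a b).Nonempty := by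
    obtain ⟨x, hx⟩ := hf.ne
    exact ⟨x, (hfi x).1 hx⟩
  have haff : ∀ s ∈ Set.Ioo a b, S s = β / α * s + (S s0 - β / α * s0) := by
    have hd : ∀ s ∈ Set.Ioo a b, HasDerivAt (fun s => S s - β / α * s) 0 s := by
      intro s hs
      have h2 := (hS s hs).fun_sub ((hasDerivAt_id s).const_mul (β / α))
      have h3 : β ^ (k + 1) / α ^ (k + 1) * f s / g (S s) = β / α := (hfin s hs).1
      rw [h3, mul_one, sub_self] at h2
      exact h2
    intro s hs
    have := isOpen_Ioo.is_const_of_deriv_eq_zero (isPreconnected_Ioo)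
      (fun s hs => (hd s hs).differentiableAt.differentiableWithinAt)
      (fun s hs => (hd s hs).deriv) hs hs0
    linarith
  refine ⟨S s0 - β / α * s0, fun s => ?_⟩
  by_cases hs : s ∈ Set.Ioo a b
  · rw [← haff s hs]; exact (hfin s hs).2
  · have hf0 : f s = 0 := le_antisymm (not_lt.1 ((hfi s).not.2 hs)) (hf.nonneg s)
    rw [hf0, mul_zero]
    refine le_antisymm (not_lt.1 fun hpos => hs ?_) (hg.nonneg _)
    have h2 := (hgi _).1 hpos
    rw [← himg] at h2
    obtain ⟨r, hr, hrs⟩ := h2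
    rw [haff r hr] at hrs
    have : r = s := by
      have h3 : β / α * r = β / α * s := by linarith
      exact mul_left_cancel₀ (by positivity) h3
    rwa [← this]

/-! ### Marginals and the Borell-Brascamp-Lieb inequality in dimension `m` -/

section Marginals

lemma compactSupport_iff {X : Type*} [NormedAddCommGroup X] [NormedSpace ℝ X]
    [FiniteDimensional ℝ X] {f : X → ℝ} :
    HasCompactSupport f ↔ ∃ R : ℝ, ∀ x, f x ≠ 0 → ‖x‖ ≤ R := by
  have : ProperSpace X := FiniteDimensional.proper ℝ X
  constructor
  · intro h
    obtain ⟨R, hR⟩ := h.isCompact.isBounded.subset_closedBall (0 : X)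
    exact ⟨R, fun x hx => by simpa using hR (subset_tsupport f hx)⟩
  · rintro ⟨R, hR⟩
    exact HasCompactSupport.of_support_subset_isCompact (isCompact_closedBall (0 : X) R)
      fun x hx => by simpa using hR x hx

lemma NiceFn.comp_equiv {X Y : Type*} [TopologicalSpace X] [AddCommGroup X] [Module ℝ X]
    [TopologicalSpace Y] [AddCommGroup Y] [Module ℝ Y] {f : X → ℝ} (hf : NiceFn f)
    (L : Y ≃L[ℝ] X) : NiceFn (fun y => f (L y)) where
  cont := hf.cont.comp L.continuous
  supp := hf.supp.comp_homeomorph L.toHomeomorph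
  nonneg := fun y => hf.nonneg _
  conv := hf.conv.linear_preimage L.toLinearEquiv.toLinearMap
  ne := by
    obtain ⟨x, hx⟩ := hf.ne
    exact ⟨L.symm x, by simpa using hx⟩

variable {m : ℕ}

/-- prepend a coordinate -/
def cons1 (s : ℝ) (x : Fin m → ℝ) : Fin (m + 1) → ℝ := Fin.cons s x

@[simp] lemma cons1_zero (s : ℝ) (x : Fin m → ℝ) : cons1 s x 0 = s := rfl

@[simp] lemma cons1_succ (s : ℝ) (x : Fin m → ℝ) (i : Fin m) : cons1 s x i.succ = x i := rfl

lemma cons1_comb (a b s r : ℝ) (x y : Fin m → ℝ) :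
    a • cons1 s x + b • cons1 r y = cons1 (a * s + b * r) (a • x + b • y) := by
  ext i
  refine Fin.cases ?_ (fun j => ?_) i <;> simp

lemma continuous_cons1 : Continuous fun p : ℝ × (Fin m → ℝ) => cons1 p.1 p.2 := by
  refine continuous_pi fun i => ?_
  refine Fin.cases ?_ (fun j => ?_) i
  · exact continuous_fst
  · simp only [cons1_succ]; fun_prop

lemma norm_le_cons1 (s : ℝ) (x : Fin m → ℝ) : ‖x‖ ≤ ‖cons1 s x‖ :=
  (pi_norm_le_iff_of_nonneg (norm_nonneg _)).2 fun i => by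
    simpa using norm_le_pi_norm (cons1 s x) i.succ

lemma abs_le_cons1 (s : ℝ) (x : Fin m → ℝ) : |s| ≤ ‖cons1 s x‖ := by
  simpa using norm_le_pi_norm (cons1 s x) 0

lemma exists_cons1 (y : Fin (m + 1) → ℝ) : ∃ s x, y = cons1 s x :=
  ⟨y 0, fun i => y i.succ, by ext i; refine Fin.cases ?_ (fun j => ?_) i <;> simp⟩

/-- marginal with respect to the first coordinate -/
noncomputable def marg (F : (Fin (m + 1) → ℝ) → ℝ) (s : ℝ) : ℝ :=
  ∫ x : Fin m → ℝ, F (cons1 s x)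

lemma integral_marg {F : (Fin (m + 1) → ℝ) → ℝ} (hF : Integrable F) :
    ∫ s, marg F s = ∫ x, F x := by
  have hp := (volume_preserving_piFinSuccAbove (fun _ : Fin (m + 1) => ℝ) 0).symm
  have he : ∀ p : ℝ × (Fin m → ℝ),
      (MeasurableEquiv.piFinSuccAbove (fun _ : Fin (m + 1) => ℝ) 0).symm p = cons1 p.1 p.2 := by
    intro p
    ext i
    refine Fin.cases ?_ (fun j => ?_) i <;> simp [cons1]
  have h1 := hp.integral_comp (MeasurableEquiv.measurableEmbedding _) F
  have h2 := (hp.integrable_comp_emb (MeasurableEquiv.measurableEmbedding _)).2 hF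
  rw [← h1]
  have h3 : ∀ p : ℝ × (Fin m → ℝ), F ((MeasurableEquiv.piFinSuccAbove
      (fun _ : Fin (m + 1) => ℝ) 0).symm p) = F (cons1 p.1 p.2) := fun p => by rw [he]
  have h4 : Integrable (fun p : ℝ × (Fin m → ℝ) => F (cons1 p.1 p.2))
      ((volume : Measure ℝ).prod (volume : Measure (Fin m → ℝ))) := by
    refine h2.congr (Filter.Eventually.of_forall fun p => ?_)
    exact h3 p
  unfold marg
  rw [integral_congr_ae (Filter.Eventually.of_forall h3)]
  exact (integral_prod _ h4).symm

lemma slice_support {F : (Fin (m + 1) → ℝ) → ℝ} (hs : HasCompactSupport F) (s : ℝ) :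
    HasCompactSupport fun x => F (cons1 s x) := by
  obtain ⟨R, hR⟩ := compactSupport_iff.1 hs
  exact compactSupport_iff.2 ⟨R, fun x hx => (norm_le_cons1 s x).trans (hR _ hx)⟩

lemma slice_cont {F : (Fin (m + 1) → ℝ) → ℝ} (hc : Continuous F) (s : ℝ) :
    Continuous fun x => F (cons1 s x) :=
  hc.comp (continuous_cons1.comp (by fun_prop : Continuous fun x : Fin m → ℝ => (s, x)))

lemma marg_cont {F : (Fin (m + 1) → ℝ) → ℝ} (hc : Continuous F) (hs : HasCompactSupport F) :
    Continuous (marg F) := by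
  obtain ⟨R, hR⟩ := compactSupport_iff.1 hs
  have h : ∀ s, marg F s = ∫ x in Metric.closedBall (0 : Fin m → ℝ) R, F (cons1 s x) := by
    intro s
    refine (setIntegral_eq_integral_of_forall_compl_eq_zero fun x hx => ?_).symm
    by_contra hne
    exact hx (by simpa using (norm_le_cons1 s x).trans (hR _ hne))
  rw [funext h]
  exact continuous_parametric_integral_of_continuous
    (f := fun (s : ℝ) (x : Fin m → ℝ) => F (cons1 s x)) (hc.comp continuous_cons1)
    (isCompact_closedBall _ _)

lemma marg_support {F : (Fin (m + 1) → ℝ) → ℝ} (hs : HasCompactSupport F) :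
    HasCompactSupport (marg F) := by
  obtain ⟨R, hR⟩ := compactSupport_iff.1 hs
  refine compactSupport_iff.2 ⟨R, fun s hne => ?_⟩
  by_contra hlt
  refine hne ?_
  have : ∀ x : Fin m → ℝ, F (cons1 s x) = 0 := fun x => by
    by_contra h
    exact hlt ((abs_le_cons1 s x).trans (hR _ h))
  unfold marg
  simp [this]

lemma marg_nonneg {F : (Fin (m + 1) → ℝ) → ℝ} (hn : ∀ x, 0 ≤ F x) (s : ℝ) : 0 ≤ marg F s :=
  integral_nonneg fun _ => hn _

lemma NiceFn.marg_pos_iff {F : (Fin (m + 1) → ℝ) → ℝ} (hF : NiceFn F) (s : ℝ) :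
    0 < marg F s ↔ ∃ x, 0 < F (cons1 s x) := by
  constructor
  · intro h
    by_contra! hall
    have : ∀ x, F (cons1 s x) = 0 := fun x => le_antisymm (hall x) (hF.nonneg _)
    unfold marg at h
    simp [this] at h
  · rintro ⟨x, hx⟩
    exact (slice_cont hF.cont s).integral_pos_of_hasCompactSupport_nonneg_nonzero
      (slice_support hF.supp s) (fun x => hF.nonneg _) hx.ne'

lemma NiceFn.slice {F : (Fin (m + 1) → ℝ) → ℝ} (hF : NiceFn F) {s : ℝ} (hs : 0 < marg F s) :
    NiceFn fun x => F (cons1 s x) where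
  cont := slice_cont hF.cont s
  supp := slice_support hF.supp s
  nonneg := fun x => hF.nonneg _
  conv := by
    intro x hx y hy a b ha hb hab
    have h := hF.conv hx hy ha hb hab
    rw [cons1_comb] at h
    rwa [show a * s + b * s = s by rw [← add_mul, hab, one_mul]] at h
  ne := (hF.marg_pos_iff s).1 hs

lemma NiceFn.marg {F : (Fin (m + 1) → ℝ) → ℝ} (hF : NiceFn F) : NiceFn (marg F) where
  cont := marg_cont hF.cont hF.supp
  supp := marg_support hF.supp
  nonneg := marg_nonneg hF.nonneg
  conv := by
    intro s hs r hr a b ha hb hab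
    obtain ⟨x, hx⟩ := (hF.marg_pos_iff s).1 hs
    obtain ⟨y, hy⟩ := (hF.marg_pos_iff r).1 hr
    have h := hF.conv hx hy ha hb hab
    rw [cons1_comb] at h
    exact (hF.marg_pos_iff _).2 ⟨_, h⟩
  ne := by
    obtain ⟨y, hy⟩ := hF.ne
    obtain ⟨s, x, rfl⟩ := exists_cons1 y
    exact ⟨s, (hF.marg_pos_iff _).2 ⟨x, hy⟩⟩

/-- Borell-Brascamp-Lieb inequality in dimension `m`. -/
theorem bbl (m : ℕ) : ∀ {k : ℕ}, 1 ≤ k → ∀ {t : ℝ}, 0 ≤ t → t ≤ 1 →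
    ∀ {f g h : (Fin m → ℝ) → ℝ}, NiceFn f → NiceFn g → Continuous h → HasCompactSupport h →
    (∀ x, 0 ≤ h x) →
    (∀ (a b : Fin m → ℝ) (u v : ℝ), 0 < u → 0 < v → f a = u ^ k → g b = v ^ k →
      ((1 - t) * u + t * v) ^ k ≤ h ((1 - t) • a + t • b)) →
    ∀ {α β : ℝ}, 0 < α → 0 < β → ∫ x, f x = α ^ (k + m) → ∫ x, g x = β ^ (k + m) →
    ((1 - t) * α + t * β) ^ (k + m) ≤ ∫ x, h x := by
  induction m with
  | zero =>
    intro k hk t ht0 ht1 f g h hf hg hc hs hn H α β hα hβ hfα hgβ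
    have hInt : ∀ q : (Fin 0 → ℝ) → ℝ, ∫ x, q x = q 0 := by
      intro q
      rw [volume_pi, Measure.pi_of_empty (x := (0 : Fin 0 → ℝ)), integral_dirac]
    rw [hInt] at hfα hgβ ⊢
    have h1 := H 0 0 α β hα hβ hfα hgβ
    rw [smul_zero, smul_zero, add_zero] at h1
    exact h1
  | succ m ih =>
    intro k hk t ht0 ht1 f g h hf hg hc hs hn H α β hα hβ hfα hgβ
    have hHm : ∀ a b u v : ℝ, 0 < u → 0 < v → marg f a = u ^ (k + m) → marg g b = v ^ (k + m) →
        ((1 - t) * u + t * v) ^ (k + m) ≤ marg h ((1 - t) * a + t * b) := by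
      intro a b u v hu hv hfu hgv
      refine ih hk ht0 ht1 (hf.slice (by rw [hfu]; positivity))
        (hg.slice (by rw [hgv]; positivity)) (slice_cont hc _) (slice_support hs _)
        (fun x => hn _) ?_ hu hv hfu hgv
      intro x y p q hp hq hfx hgy
      have := H _ _ p q hp hq hfx hgy
      rwa [cons1_comb] at this
    have hInt : ∀ {q : (Fin (m + 1) → ℝ) → ℝ}, Continuous q → HasCompactSupport q →
        ∫ s, marg q s = ∫ x, q x := fun hq1 hq2 =>
      integral_marg (hq1.integrable_of_hasCompactSupport hq2)
    have h1 := (bbl_one (k := k + m) (by omega) ht0 ht1 hf.marg hg.marg (marg_cont hc hs)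
      ((marg_cont hc hs).integrable_of_hasCompactSupport (marg_support hs)) (marg_nonneg hn)
      hHm hα hβ (by rw [hInt hf.cont hf.supp, hfα]; rfl)
      (by rw [hInt hg.cont hg.supp, hgβ]; rfl)).1
    rw [hInt hc hs] at h1
    exact h1

/-- Equality in the Borell-Brascamp-Lieb inequality: the first marginals are homothetic. -/
theorem bbl_eq {m k : ℕ} (hk : 1 ≤ k) {t : ℝ} (ht0 : 0 < t) (ht1 : t < 1)
    {f g h : (Fin (m + 1) → ℝ) → ℝ} (hf : NiceFn f) (hg : NiceFn g) (hc : Continuous h)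
    (hs : HasCompactSupport h) (hn : ∀ x, 0 ≤ h x)
    (H : ∀ (a b : Fin (m + 1) → ℝ) (u v : ℝ), 0 < u → 0 < v → f a = u ^ k → g b = v ^ k →
      ((1 - t) * u + t * v) ^ k ≤ h ((1 - t) • a + t • b))
    {α β : ℝ} (hα : 0 < α) (hβ : 0 < β) (hfα : ∫ x, f x = α ^ (k + m + 1))
    (hgβ : ∫ x, g x = β ^ (k + m + 1))
    (heq : ∫ x, h x ≤ ((1 - t) * α + t * β) ^ (k + m + 1)) :
    ∃ c, ∀ s, marg g (β / α * s + c) = (β / α) ^ (k + m) * marg f s := by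
  have hHm : ∀ a b u v : ℝ, 0 < u → 0 < v → marg f a = u ^ (k + m) → marg g b = v ^ (k + m) →
      ((1 - t) * u + t * v) ^ (k + m) ≤ marg h ((1 - t) * a + t * b) := by
    intro a b u v hu hv hfu hgv
    refine bbl m hk ht0.le ht1.le (hf.slice (by rw [hfu]; positivity))
      (hg.slice (by rw [hgv]; positivity)) (slice_cont hc _) (slice_support hs _)
      (fun x => hn _) ?_ hu hv hfu hgv
    intro x y p q hp hq hfx hgy
    have := H _ _ p q hp hq hfx hgy
    rwa [cons1_comb] at this
  have hInt : ∀ {q : (Fin (m + 1) → ℝ) → ℝ}, Continuous q → HasCompactSupport q →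
      ∫ s, marg q s = ∫ x, q x := fun hq1 hq2 =>
    integral_marg (hq1.integrable_of_hasCompactSupport hq2)
  refine (bbl_one (k := k + m) (by omega) ht0.le ht1.le hf.marg hg.marg (marg_cont hc hs)
    ((marg_cont hc hs).integrable_of_hasCompactSupport (marg_support hs)) (marg_nonneg hn)
    hHm hα hβ (by rw [hInt hf.cont hf.supp, hfα])
    (by rw [hInt hg.cont hg.supp, hgβ])).2 ht0 ht1 ?_
  rw [hInt hc hs]
  exact heq

end Marginals

/-! ### Assembly -/

section Assembly

variable {n m : ℕ}

local notation "E" => EuclideanSpace ℝ (Fin n)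

local notation "ES" => EuclideanSpace ℝ (Fin (m + 1))

lemma ofLp_measurePreserving : MeasurePreserving
    (EuclideanSpace.equiv (Fin n) ℝ) (volume : Measure E) volume := by
  exact PiLp.volume_preserving_ofLp (Fin n)

lemma exists_direction (e : ES) (he : ‖e‖ = 1) : ∃ L : ES ≃L[ℝ] (Fin (m + 1) → ℝ),
    MeasurePreserving L volume volume ∧ ∀ x, L x 0 = inner ℝ e x := by
  let v : Fin (m + 1) → ES := fun _ => e
  have hv : Orthonormal ℝ (({0} : Set (Fin (m + 1))).domRestrict v) := by
    constructor
    · intro i; exact he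
    · intro i j hij
      exact absurd (Subsingleton.elim i j) hij
  obtain ⟨b, hb⟩ := hv.exists_orthonormalBasis_extension_of_card_eq (by simp)
  refine ⟨b.repr.toContinuousLinearEquiv.trans (EuclideanSpace.equiv (Fin (m + 1)) ℝ), ?_, ?_⟩
  · exact ofLp_measurePreserving.comp b.repr.measurePreserving
  · intro x
    have := b.repr_apply_apply x 0
    rw [hb 0 rfl] at this
    simpa [v] using this

lemma ext_nice {Ω : Set E} {U : E → ℝ} (hc : IsCompact Ω) (hconv : Convex ℝ Ω)
    (hInt : (interior Ω).Nonempty) (hU : IsTorsionFn Ω U) : NiceFn (Ω.indicator U) where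
  cont := ext_continuous hU
  supp := ext_support hc
  nonneg := ext_nonneg hc hU
  conv := by
    have : {x | 0 < Ω.indicator U x} = interior Ω := by
      ext x; exact ext_pos_iff hc hU x
    rw [this]; exact hconv.interior
  ne := by
    obtain ⟨x, hx⟩ := hInt
    exact ⟨x, (ext_pos_iff hc hU x).2 hx⟩

lemma NiceFn.integral_pos' {f : E → ℝ} (hf : NiceFn f) : 0 < ∫ x, f x := by
  obtain ⟨x, hx⟩ := hf.ne
  exact hf.cont.integral_pos_of_hasCompactSupport_nonneg_nonzero hf.supp hf.nonneg hx.ne'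

lemma ext_H {Ω Ω' : Set E} {U U' Ut : E → ℝ} {t : ℝ} (hc : IsCompact Ω) (hc' : IsCompact Ω')
    (hct : IsCompact ((1 - t) • Ω + t • Ω'))
    (ht0 : 0 ≤ t) (ht1 : t ≤ 1)
    (hU : IsTorsionFn Ω U) (hU' : IsTorsionFn Ω' U') (hUt : IsTorsionFn ((1 - t) • Ω + t • Ω') Ut)
    (a b : E) (u v : ℝ) (hu : 0 < u) (hv : 0 < v) (ha : Ω.indicator U a = u ^ 2)
    (hb : Ω'.indicator U' b = v ^ 2) :
    ((1 - t) * u + t * v) ^ 2 ≤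
      ((1 - t) • Ω + t • Ω').indicator Ut ((1 - t) • a + t • b) := by
  have hmap : ∀ x ∈ Ω, ∀ y ∈ Ω', (1 - t) • x + t • y ∈ (1 - t) • Ω + t • Ω' := fun x hx y hy =>
    Set.add_mem_add (Set.smul_mem_smul_set hx) (Set.smul_mem_smul_set hy)
  have haΩ : a ∈ Ω := by
    by_contra h
    rw [Set.indicator_of_notMem h] at ha
    nlinarith
  have hbΩ : b ∈ Ω' := by
    by_contra h
    rw [Set.indicator_of_notMem h] at hb
    nlinarith
  rw [Set.indicator_of_mem haΩ] at ha
  rw [Set.indicator_of_mem hbΩ] at hb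
  have h := two_point hc hc' hct hU hU' hUt (α := 1 - t) (β := t) 0
    (fun x hx y hy => by simpa using hmap x hx y hy) haΩ hbΩ
  rw [zero_add, ha, hb, Real.sqrt_sq hu.le, Real.sqrt_sq hv.le] at h
  have hz := hmap a haΩ b hbΩ
  rw [Set.indicator_of_mem hz]
  have h0 : 0 ≤ (1 - t) * u + t * v := by
    have : 0 ≤ 1 - t := by linarith
    positivity
  calc ((1 - t) * u + t * v) ^ 2 ≤ √(Ut ((1 - t) • a + t • b)) ^ 2 := by gcongr
    _ = _ := Real.sq_sqrt (torsion_nonneg hct hUt hz)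

lemma bbl_E {t : ℝ} (ht0 : 0 ≤ t) (ht1 : t ≤ 1) {f g h : E → ℝ}
    (hf : NiceFn f) (hg : NiceFn g) (hc : Continuous h) (hs : HasCompactSupport h)
    (hn : ∀ x, 0 ≤ h x)
    (H : ∀ (a b : E) (u v : ℝ), 0 < u → 0 < v → f a = u ^ 2 → g b = v ^ 2 →
      ((1 - t) * u + t * v) ^ 2 ≤ h ((1 - t) • a + t • b))
    {α β : ℝ} (hα : 0 < α) (hβ : 0 < β) (hfα : ∫ x, f x = α ^ (2 + n))
    (hgβ : ∫ x, g x = β ^ (2 + n)) :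
    ((1 - t) * α + t * β) ^ (2 + n) ≤ ∫ x, h x := by
  let L := EuclideanSpace.equiv (Fin n) ℝ
  have hL : MeasurePreserving L (volume : Measure E) volume := ofLp_measurePreserving
  have hI : ∀ q : E → ℝ, ∫ y, q (L.symm y) = ∫ x, q x := fun q => by
    have := hL.integral_comp L.toHomeomorph.measurableEmbedding (fun y => q (L.symm y))
    rw [← this]; simp
  have := bbl n (k := 2) (by norm_num) ht0 ht1 (hf.comp_equiv L.symm) (hg.comp_equiv L.symm)
    (hc.comp L.symm.continuous) (hs.comp_homeomorph L.symm.toHomeomorph) (fun x => hn _)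
    (fun a b u v hu hv ha hb => by
      have := H _ _ u v hu hv ha hb
      simpa using this) hα hβ ((hI f).trans hfα) ((hI g).trans hgβ)
  exact this.trans_eq (hI h)

lemma marg_fst_mul (F : (Fin (m + 1) → ℝ) → ℝ) (s : ℝ) :
    marg (fun y => y 0 * F y) s = s * marg F s := by
  unfold marg
  simp only [cons1_zero]
  exact integral_const_mul _ _

lemma bbl_E_eq {t : ℝ} (ht0 : 0 < t) (ht1 : t < 1) {f g h : ES → ℝ}
    (hf : NiceFn f) (hg : NiceFn g) (hc : Continuous h) (hs : HasCompactSupport h)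
    (hn : ∀ x, 0 ≤ h x)
    (H : ∀ (a b : ES) (u v : ℝ), 0 < u → 0 < v → f a = u ^ 2 → g b = v ^ 2 →
      ((1 - t) * u + t * v) ^ 2 ≤ h ((1 - t) • a + t • b))
    {α β : ℝ} (hα : 0 < α) (hβ : 0 < β) (hfα : ∫ x, f x = α ^ (2 + m + 1))
    (hgβ : ∫ x, g x = β ^ (2 + m + 1))
    (heq : ∫ x, h x ≤ ((1 - t) * α + t * β) ^ (2 + m + 1)) (e : ES) (he : ‖e‖ = 1) :
    ∃ c : ℝ, (∀ s, (∃ x, 0 < g x ∧ inner ℝ e x = β / α * s + c) ↔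
        ∃ x, 0 < f x ∧ inner ℝ e x = s) ∧
      ∫ x, inner ℝ e x * g x = (β / α) ^ (2 + m + 1) *
        (β / α * (∫ x, inner ℝ e x * f x) + c * ∫ x, f x) := by
  obtain ⟨L, hL, hLe⟩ := exists_direction e he
  have hI : ∀ q : ES → ℝ, ∫ y, q (L.symm y) = ∫ x, q x := fun q => by
    have := hL.integral_comp L.toHomeomorph.measurableEmbedding (fun y => q (L.symm y))
    rw [← this]; simp
  have hF := hf.comp_equiv L.symm
  have hG := hg.comp_equiv L.symm
  obtain ⟨c, hcc⟩ := bbl_eq (k := 2) (by norm_num) ht0 ht1 hF hG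
    (hc.comp L.symm.continuous) (hs.comp_homeomorph L.symm.toHomeomorph) (fun x => hn _)
    (fun a b u v hu hv ha hb => by
      have := H _ _ u v hu hv ha hb
      simpa using this) hα hβ ((hI f).trans hfα) ((hI g).trans hgβ) ((hI h).trans_le heq)
  set lam := β / α with hlam
  have hlam0 : 0 < lam := div_pos hβ hα
  have hposiff : ∀ {q : ES → ℝ}, NiceFn (fun y => q (L.symm y)) → ∀ s,
      0 < marg (fun y => q (L.symm y)) s ↔ ∃ x, 0 < q x ∧ inner ℝ e x = s := by
    intro q hq s
    rw [hq.marg_pos_iff]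
    constructor
    · rintro ⟨x, hx⟩
      exact ⟨_, hx, by rw [← hLe]; simp⟩
    · rintro ⟨x, hx, hxs⟩
      obtain ⟨s', y, hy⟩ := exists_cons1 (L x)
      have : s' = s := by rw [← hxs, ← hLe, hy]; rfl
      subst this
      exact ⟨y, by rw [← hy]; simpa using hx⟩
  have hmom : ∀ {q : ES → ℝ}, NiceFn (fun y => q (L.symm y)) →
      ∫ s, s * marg (fun y => q (L.symm y)) s = ∫ x, inner ℝ e x * q x := by
    intro q hq
    have h1 : Integrable (fun y : Fin (m + 1) → ℝ => y 0 * q (L.symm y)) :=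
      ((continuous_apply 0).mul hq.cont).integrable_of_hasCompactSupport hq.supp.mul_left
    have h2 := integral_marg h1
    simp only [marg_fst_mul] at h2
    rw [h2, ← hI]
    congr 1; ext y
    rw [← hLe]; simp
  have hmass : ∀ {q : ES → ℝ}, NiceFn (fun y => q (L.symm y)) →
      ∫ s, marg (fun y => q (L.symm y)) s = ∫ x, q x := by
    intro q hq
    rw [integral_marg (hq.cont.integrable_of_hasCompactSupport hq.supp), hI]
  refine ⟨c, fun s => ?_, ?_⟩
  · rw [← hposiff hF, ← hposiff hG, hcc]
    exact mul_pos_iff_of_pos_left (by positivity)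
  · rw [← hmom hG, ← hmom hF, ← hmass hF]
    have hMi : Integrable (marg fun y => f (L.symm y)) :=
      hF.marg.cont.integrable_of_hasCompactSupport hF.marg.supp
    have hMs : Integrable fun s => s * marg (fun y => f (L.symm y)) s :=
      (continuous_id.mul hF.marg.cont).integrable_of_hasCompactSupport hF.marg.supp.mul_left
    have hsub : ∀ p : ℝ → ℝ, ∫ s, p s = lam * ∫ s, p (lam * s + c) := by
      intro p
      rw [Measure.integral_comp_mul_left (fun s => p (s + c)), integral_add_right_eq_self,
        smul_eq_mul, abs_of_pos (inv_pos.2 hlam0), ← mul_assoc, mul_inv_cancel₀ hlam0.ne', one_mul]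
    rw [hsub]
    simp only [hcc]
    have : ∀ s, (lam * s + c) * (lam ^ (2 + m) * marg (fun y => f (L.symm y)) s) =
        lam ^ (2 + m) * (lam * (s * marg (fun y => f (L.symm y)) s) +
          c * marg (fun y => f (L.symm y)) s) := fun s => by ring
    simp only [this]
    rw [integral_const_mul, integral_add (hMs.const_mul _) (hMi.const_mul _), integral_const_mul,
      integral_const_mul]
    ring

/-- If all open projections of `A` lie in those of `B`, then `A ⊆ B`. -/
lemma subset_of_proj {A B : Set E} (hB : IsClosed B) (hBc : Convex ℝ B)
    (h : ∀ e : E, ‖e‖ = 1 → ∀ x ∈ A, ∃ y ∈ B, inner ℝ e y = inner ℝ e x) (hA : B.Nonempty) :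
    A ⊆ B := by
  intro x hx
  by_contra hxB
  obtain ⟨f, u, hu, hux⟩ := geometric_hahn_banach_closed_point hBc hB hxB
  obtain ⟨w, hw⟩ : ∃ w : E, ∀ z, f z = inner ℝ w z :=
    ⟨(InnerProductSpace.toDual ℝ E).symm f, fun z => by simp⟩
  have hw0 : w ≠ 0 := by
    rintro rfl
    obtain ⟨b, hb⟩ := hA
    have := hu b hb
    rw [hw] at this hux
    simp at this hux
    linarith
  have hwn : 0 < ‖w‖ := norm_pos_iff.2 hw0
  obtain ⟨y, hy, hyx⟩ := h (‖w‖⁻¹ • w) (by rw [norm_smul]; simp [hwn.ne']) x hx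
  rw [real_inner_smul_left, real_inner_smul_left] at hyx
  have := mul_left_cancel₀ (inv_ne_zero hwn.ne') hyx
  have h1 := hu y hy
  rw [hw] at h1 hux
  linarith

lemma closed_eq {Ω : Set E} (hc : IsCompact Ω) (hconv : Convex ℝ Ω)
    (hInt : (interior Ω).Nonempty) : closure (interior Ω) = Ω := by
  rw [hconv.closure_interior_eq_closure_of_nonempty_interior hInt, hc.isClosed.closure_eq]

lemma homothety_of_proj {Ω Ω' : Set E} (hc : IsCompact Ω) (hconv : Convex ℝ Ω)
    (hInt : (interior Ω).Nonempty) (hc' : IsCompact Ω') (hconv' : Convex ℝ Ω')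
    (hInt' : (interior Ω').Nonempty) {lam : ℝ} (hl : 0 < lam) (c : E)
    (h : ∀ e : E, ‖e‖ = 1 → ∀ s, (∃ x ∈ interior Ω', inner ℝ e x = lam * s + inner ℝ e c) ↔
      ∃ x ∈ interior Ω, inner ℝ e x = s) :
    Ω' = (fun y => c + lam • y) '' Ω := by
  have hφ : Continuous fun y : E => c + lam • y := by fun_prop
  have hCc : IsCompact ((fun y : E => c + lam • y) '' Ω) := hc.image hφ
  have hCconv : Convex ℝ ((fun y : E => c + lam • y) '' Ω) := by
    have := (hconv.smul lam).translate c
    rwa [← Set.image_smul, Set.image_image] at this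
  apply Set.Subset.antisymm
  · rw [← closed_eq hc' hconv' hInt']
    refine closure_minimal ?_ hCc.isClosed
    refine subset_of_proj hCc.isClosed hCconv ?_ ((hInt.mono interior_subset).image _)
    intro e he x hx
    obtain ⟨y, hy, hys⟩ := (h e he ((inner ℝ e x - inner ℝ e c) / lam)).1
      ⟨x, hx, by field_simp; ring⟩
    refine ⟨_, ⟨y, interior_subset hy, rfl⟩, ?_⟩
    simp only [inner_add_right, real_inner_smul_right, hys]
    field_simp; ring
  · rw [← closed_eq hc hconv hInt]
    refine (image_closure_subset_closure_image hφ).trans ?_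
    refine closure_minimal ?_ hc'.isClosed
    refine subset_of_proj hc'.isClosed hconv' ?_ (hInt'.mono interior_subset)
    rintro e he _ ⟨x, hx, rfl⟩
    obtain ⟨y, hy, hys⟩ := (h e he (inner ℝ e x)).2 ⟨x, hx, rfl⟩
    refine ⟨y, interior_subset hy, ?_⟩
    simp only [inner_add_right, real_inner_smul_right, hys]
    ring

/-- The torsional rigidity of a homothetic copy. -/
lemma torsion_homothety {Ω Ω₂ : Set E} {U U₂ : E → ℝ} (hc : IsCompact Ω) (hconv : Convex ℝ Ω)
    (hU : IsTorsionFn Ω U) (hU₂ : IsTorsionFn Ω₂ U₂) {a : ℝ} (ha : 0 < a) (c : E)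
    (h : Ω₂ = (fun y => c + a • y) '' Ω) : torsion Ω₂ U₂ = a ^ (n + 2) * torsion Ω U := by
  have hc₂ : IsCompact Ω₂ := by rw [h]; exact hc.image (by fun_prop)
  have hconv₂ : Convex ℝ Ω₂ := by
    have := (hconv.smul a).translate c
    rwa [← Set.image_smul, Set.image_image, ← h] at this
  have hmem : ∀ y, c + a • y ∈ Ω₂ ↔ y ∈ Ω := by
    intro y
    rw [h]
    constructor
    · rintro ⟨z, hz, hzy⟩
      have h1 : a • z = a • y := add_left_cancel hzy
      have h2 : z = y := smul_right_injective E ha.ne' h1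
      exact h2 ▸ hz
    · exact fun hy => ⟨y, hy, rfl⟩
  have hval : ∀ y, Ω₂.indicator U₂ (c + a • y) = a ^ 2 * Ω.indicator U y := by
    intro y
    by_cases hy : y ∈ Ω
    · have hy₂ := (hmem y).2 hy
      rw [Set.indicator_of_mem hy, Set.indicator_of_mem hy₂]
      have h1 := two_point hc hc hc₂ hU hU hU₂ (α := a) (β := 0) c
        (fun x hx y _ => by simpa using (hmem x).2 hx) hy hy
      have h2 := two_point hc₂ hc₂ hc hU₂ hU₂ hU (α := a⁻¹) (β := 0) (-(a⁻¹ • c))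
        (fun x hx y _ => by
          rw [h] at hx
          obtain ⟨z, hz, rfl⟩ := hx
          simpa [smul_smul, ha.ne'] using hz) hy₂ hy₂
      have e2 : -(a⁻¹ • c) + a⁻¹ • (c + a • y) + (0 : ℝ) • (c + a • y) = y := by
        simp [smul_smul, ha.ne']
      rw [e2] at h2
      simp only [zero_smul, add_zero, zero_mul] at h1 h2
      have h3 : √(U₂ (c + a • y)) ≤ a * √(U y) := by
        have := mul_le_mul_of_nonneg_left h2 ha.le
        rwa [← mul_assoc, mul_inv_cancel₀ ha.ne', one_mul] at this
      have h4 := le_antisymm h3 h1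
      rw [← Real.sq_sqrt (torsion_nonneg hc₂ hU₂ hy₂), h4, mul_pow,
        Real.sq_sqrt (torsion_nonneg hc hU hy)]
    · rw [Set.indicator_of_notMem hy, Set.indicator_of_notMem ((hmem y).not.2 hy), mul_zero]
  rw [torsion_eq hc hconv hU, torsion_eq hc₂ hconv₂ hU₂]
  have h5 : ∫ y, Ω₂.indicator U₂ (c + a • y) = (a ^ n)⁻¹ * ∫ y, Ω₂.indicator U₂ y := by
    rw [Measure.integral_comp_smul volume (fun y => Ω₂.indicator U₂ (c + y)),
      integral_add_left_eq_self]
    simp only [finrank_euclideanSpace, Fintype.card_fin, smul_eq_mul]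
    rw [abs_of_pos (by positivity)]
  simp only [hval] at h5
  rw [integral_const_mul] at h5
  field_simp at h5
  rw [← h5]; ring

lemma torsion_dim_pos {Ω : Set E} {U : E → ℝ} (hInt : (interior Ω).Nonempty)
    (hU : IsTorsionFn Ω U) : n ≠ 0 := by
  rintro rfl
  obtain ⟨x, hx⟩ := hInt
  have := hU.2.2.1 x hx
  simp [lap] at this

lemma root_pow {x α : ℝ} (hα : 0 < α) (hx : x = α ^ (2 + n)) :
    (2 * x) ^ ((1 : ℝ) / (n + 2)) = 2 ^ ((1 : ℝ) / (n + 2)) * α := by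
  rw [Real.mul_rpow (by norm_num) (by rw [hx]; positivity), hx, ← Real.rpow_natCast,
    ← Real.rpow_mul hα.le]
  congr 1
  have : ((2 + n : ℕ) : ℝ) * (1 / (n + 2)) = 1 := by
    push_cast; field_simp; ring
  rw [this, Real.rpow_one]

end Assembly

/-- **Brunn-Minkowski inequality for torsional rigidity** (Borell; equality case by
Colesanti): if `Ω, Ω'` are convex bodies in `ℝⁿ` and `t ∈ [0,1]`, then
`T((1-t)Ω + tΩ')^(1/(n+2)) ≥ (1-t) T(Ω)^(1/(n+2)) + t T(Ω')^(1/(n+2))`, and for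
`t ∈ (0,1)` equality holds if and only if `Ω` is homothetic to `Ω'`. -/
theorem stmt_14 (n : ℕ) (Ω Ω' : Set (EuclideanSpace ℝ (Fin n)))
    (hΩc : IsCompact Ω) (hΩconv : Convex ℝ Ω) (hΩint : (interior Ω).Nonempty)
    (hΩ'c : IsCompact Ω') (hΩ'conv : Convex ℝ Ω') (hΩ'int : (interior Ω').Nonempty)
    (t : ℝ) (ht0 : 0 ≤ t) (ht1 : t ≤ 1)
    (U U' Ut : EuclideanSpace ℝ (Fin n) → ℝ)
    (hU : IsTorsionFn Ω U) (hU' : IsTorsionFn Ω' U')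
    (hUt : IsTorsionFn ((1 - t) • Ω + t • Ω') Ut) :
    torsion ((1 - t) • Ω + t • Ω') Ut ^ ((1 : ℝ) / (n + 2)) ≥
        (1 - t) * torsion Ω U ^ ((1 : ℝ) / (n + 2)) +
          t * torsion Ω' U' ^ ((1 : ℝ) / (n + 2)) ∧
      (0 < t → t < 1 →
        (torsion ((1 - t) • Ω + t • Ω') Ut ^ ((1 : ℝ) / (n + 2)) =
            (1 - t) * torsion Ω U ^ ((1 : ℝ) / (n + 2)) +
              t * torsion Ω' U' ^ ((1 : ℝ) / (n + 2)) ↔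
          ∃ (a : ℝ) (x : EuclideanSpace ℝ (Fin n)), 0 < a ∧
            Ω' = (fun y => x + a • y) '' Ω)) := by
  obtain ⟨m, rfl⟩ : ∃ m, n = m + 1 := Nat.exists_eq_succ_of_ne_zero (torsion_dim_pos hΩint hU)
  have hct : IsCompact ((1 - t) • Ω + t • Ω') := (hΩc.smul (1 - t)).add (hΩ'c.smul t)
  have hconvt : Convex ℝ ((1 - t) • Ω + t • Ω') := (hΩconv.smul (1 - t)).add (hΩ'conv.smul t)
  have hf := ext_nice hΩc hΩconv hΩint hU
  have hg := ext_nice hΩ'c hΩ'conv hΩ'int hU'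
  have H := ext_H hΩc hΩ'c hct ht0 ht1 hU hU' hUt
  obtain ⟨α, hα, hfα⟩ := exists_root hf.integral_pos' (k := 2 + (m + 1)) (by omega)
  obtain ⟨β, hβ, hgβ⟩ := exists_root hg.integral_pos' (k := 2 + (m + 1)) (by omega)
  have hmain := bbl_E ht0 ht1 hf hg (ext_continuous hUt) (ext_support hct)
    (ext_nonneg hct hUt) H hα hβ hfα.symm hgβ.symm
  have hαβ : 0 < (1 - t) * α + t * β := by
    rcases ht0.eq_or_lt with h | h
    · rw [← h]; simpa using hα
    · have : 0 ≤ 1 - t := by linarith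
      positivity
  obtain ⟨γ, hγ, hhγ⟩ := exists_root (lt_of_lt_of_le (by positivity) hmain)
    (k := 2 + (m + 1)) (by omega)
  have h2 : (0 : ℝ) < 2 ^ ((1 : ℝ) / ((m + 1 : ℕ) + 2)) := by positivity
  have hT := root_pow hα hfα.symm
  have hT' := root_pow hβ hgβ.symm
  have hTt := root_pow hγ hhγ.symm
  rw [← torsion_eq hΩc hΩconv hU] at hT
  rw [← torsion_eq hΩ'c hΩ'conv hU'] at hT'
  rw [← torsion_eq hct hconvt hUt] at hTt
  refine ⟨?_, fun h0 h1 => ⟨fun heq => ?_, ?_⟩⟩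
  · rw [hT, hT', hTt]
    rw [← hhγ] at hmain
    have := le_of_pow_le_pow_left₀ (by omega) hγ.le hmain
    nlinarith
  · rw [hT, hT', hTt] at heq
    have hγe : γ = (1 - t) * α + t * β := by
      apply mul_left_cancel₀ h2.ne'
      rw [heq]; ring
    have hle : ∫ x, ((1 - t) • Ω + t • Ω').indicator Ut x ≤
        ((1 - t) * α + t * β) ^ (2 + m + 1) := by
      rw [← hγe, ← hhγ]; rfl
    have hdir := bbl_E_eq h0 h1 hf hg (ext_continuous hUt) (ext_support hct)
      (ext_nonneg hct hUt) H hα hβ hfα.symm hgβ.symm hle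
    have hlam : 0 < β / α := div_pos hβ hα
    have hmom : ∀ {q : EuclideanSpace ℝ (Fin (m + 1)) → ℝ}, NiceFn q → ∀ e,
        ∫ x, inner ℝ e x * q x = inner ℝ e (∫ x, q x • x) := by
      intro q hq e
      have hi : Integrable fun x => q x • x :=
        (hq.cont.smul continuous_id).integrable_of_hasCompactSupport hq.supp.smul_right
      rw [← integral_inner hi]
      congr 1; ext x
      rw [real_inner_smul_right]; ring
    have hI := hf.integral_pos'
    set I := ∫ x, Ω.indicator U x
    set p := ∫ x, Ω.indicator U x • x
    set q := ∫ x, Ω'.indicator U' x • x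
    set lam := β / α
    refine ⟨lam, ((lam ^ (2 + m + 1) * I)⁻¹ : ℝ) • (q - lam ^ (2 + m + 2) • p), hlam, ?_⟩
    refine homothety_of_proj hΩc hΩconv hΩint hΩ'c hΩ'conv hΩ'int hlam _ ?_
    intro e he s
    obtain ⟨c, hc1, hc2⟩ := hdir e he
    rw [hmom hg, hmom hf] at hc2
    have hce : inner ℝ e (((lam ^ (2 + m + 1) * I)⁻¹ : ℝ) • (q - lam ^ (2 + m + 2) • p)) = c := by
      rw [real_inner_smul_right, inner_sub_right, real_inner_smul_right, hc2]
      field_simp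
      ring
    rw [hce]
    have := hc1 s
    simp only [ext_pos_iff hΩc hU, ext_pos_iff hΩ'c hU'] at this
    exact this
  · rintro ⟨a, x, ha, hΩ'⟩
    have hb : 0 < 1 - t + t * a := by
      have : 0 < 1 - t := by linarith
      positivity
    have hset : (1 - t) • Ω + t • Ω' = (fun y => t • x + (1 - t + t * a) • y) '' Ω := by
      ext z
      constructor
      · rintro ⟨_, ⟨y, hy, rfl⟩, _, ⟨w, hw, rfl⟩, rfl⟩
        rw [hΩ'] at hw
        obtain ⟨y', hy', rfl⟩ := hw
        refine ⟨((1 - t) / (1 - t + t * a)) • y + ((t * a) / (1 - t + t * a)) • y', ?_, ?_⟩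
        · refine hΩconv hy hy' (div_nonneg (by linarith) hb.le) (by positivity) ?_
          rw [← add_div, div_self hb.ne']
        · simp only [smul_add, smul_smul]
          rw [mul_div_cancel₀ _ hb.ne', mul_div_cancel₀ _ hb.ne']
          abel
      · rintro ⟨y, hy, rfl⟩
        refine ⟨_, ⟨y, hy, rfl⟩, _, ⟨x + a • y, hΩ' ▸ ⟨y, hy, rfl⟩, rfl⟩, ?_⟩
        simp only [smul_add, smul_smul, add_smul]
        abel
    have hroot : ∀ b : ℝ, 0 < b →
        (b ^ (m + 1 + 2) * torsion Ω U) ^ ((1 : ℝ) / ((m + 1 : ℕ) + 2)) =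
          b * torsion Ω U ^ ((1 : ℝ) / ((m + 1 : ℕ) + 2)) := by
      intro b hb
      have hTn : 0 ≤ torsion Ω U := integral_nonneg fun x => by positivity
      rw [Real.mul_rpow (by positivity) hTn, ← Real.rpow_natCast, ← Real.rpow_mul hb.le]
      congr 1
      have : ((m + 1 + 2 : ℕ) : ℝ) * (1 / ((m + 1 : ℕ) + 2)) = 1 := by
        push_cast; field_simp
      rw [this, Real.rpow_one]
    rw [torsion_homothety hΩc hΩconv hU hU' ha x hΩ',
      torsion_homothety hΩc hΩconv hU hUt hb _ hset, hroot a ha, hroot _ hb]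
    ring
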